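/- arXiv:0706.1291 — 2 statements merged into one kernel-verified Lean document; each statement's English description precedes it below -/
import Mathlib

section
/- For every smooth compactly supported function φ : ℝ³ → ℂ², one has the critical Hardy–Dirac inequality ∫_{ℝ³} ( |σ·∇φ(x)|² / (1 + 1/|x|) + |φ(x)|² ) dx ≥ ∫_{ℝ³} |φ(x)|²/|x| dx. -/
open MeasureTheory

noncomputable section

/-- `σ·∇φ`, built from the Pauli matrices `σ₁ = [[0,1],[1,0]]`, `σ₂ = [[0,-i],[i,0]]`,
`σ₃ = [[1,0],[0,-1]]` acting on the partial derivatives of `φ`: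
`σ·∇φ = σ₁ ∂₁φ + σ₂ ∂₂φ + σ₃ ∂₃φ`. -/
def pauliGrad (φ : EuclideanSpace ℝ (Fin 3) → EuclideanSpace ℂ (Fin 2))
    (x : EuclideanSpace ℝ (Fin 3)) : EuclideanSpace ℂ (Fin 2) :=
  let d : Fin 3 → EuclideanSpace ℂ (Fin 2) :=
    fun k => fderiv ℝ φ x (EuclideanSpace.single k (1 : ℝ))
  (WithLp.equiv 2 (Fin 2 → ℂ)).symm
    ![ d 0 1 - Complex.I * d 1 1 + d 2 0,
       d 0 0 + Complex.I * d 1 0 - d 2 1 ]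

/-- `φ ∈ C_c^∞(ℝ³, ℂ²)`: smooth and compactly supported. -/
def IsTestFun (φ : EuclideanSpace ℝ (Fin 3) → EuclideanSpace ℂ (Fin 2)) : Prop :=
  ContDiff ℝ (⊤ : ℕ∞) φ ∧ HasCompactSupport φ

open scoped ContDiff

section Clifford

variable {F : Type*} [NormedAddCommGroup F] [InnerProductSpace ℝ F]

/-- A triple of symmetric operators satisfying the Clifford relations. -/
structure IsCliffordTriple (σ : Fin 3 → F →L[ℝ] F) : Prop where
  symm : ∀ i u v, inner ℝ (σ i u) v = inner ℝ u (σ i v)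
  anticomm : ∀ i j u, σ i (σ j u) + σ j (σ i u) = (if i = j then (2 : ℝ) else 0) • u

/-- Clifford multiplication by the vector `x`. -/
def cliffMul (σ : Fin 3 → F →L[ℝ] F) (x : EuclideanSpace ℝ (Fin 3)) : F →L[ℝ] F :=
  ∑ i, x i • σ i

/-- The Dirac operator `∑ i, σ i ∂ᵢ`. -/
def diracOp (σ : Fin 3 → F →L[ℝ] F) (f : EuclideanSpace ℝ (Fin 3) → F)
    (x : EuclideanSpace ℝ (Fin 3)) : F :=
  ∑ i, σ i (fderiv ℝ f x (EuclideanSpace.single i 1))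

/-- The spin-orbit operator `x · ∇ - (σ · x) (σ · ∇)`. -/
def spinOrbit (σ : Fin 3 → F →L[ℝ] F) (f : EuclideanSpace ℝ (Fin 3) → F)
    (x : EuclideanSpace ℝ (Fin 3)) : F :=
  fderiv ℝ f x x - cliffMul σ x (diracOp σ f x)

variable {σ : Fin 3 → F →L[ℝ] F}

lemma cliffMul_apply (x : EuclideanSpace ℝ (Fin 3)) (u : F) :
    cliffMul σ x u = ∑ i, x i • σ i u := by
  simp [cliffMul]

lemma cliffMul_cliffMul (hσ : IsCliffordTriple σ) (x : EuclideanSpace ℝ (Fin 3)) (u : F) :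
    cliffMul σ x (cliffMul σ x u) = ‖x‖ ^ 2 • u := by
  have h1 : cliffMul σ x (cliffMul σ x u) = ∑ i, ∑ j, (x i * x j) • σ i (σ j u) := by
    simp_rw [cliffMul_apply x (cliffMul σ x u), cliffMul_apply x u, map_sum, map_smul,
      Finset.smul_sum, smul_smul]
  have h2 : cliffMul σ x (cliffMul σ x u) = ∑ i, ∑ j, (x i * x j) • σ j (σ i u) := by
    rw [h1, Finset.sum_comm]
    exact Finset.sum_congr rfl fun i _ => Finset.sum_congr rfl fun j _ => by rw [mul_comm]
  have h3 : (2 : ℝ) • cliffMul σ x (cliffMul σ x u) = (2 : ℝ) • ‖x‖ ^ 2 • u := by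
    rw [two_smul]
    nth_rewrite 1 [h1]
    rw [h2, ← Finset.sum_add_distrib, EuclideanSpace.norm_sq_eq]
    simp_rw [← Finset.sum_add_distrib, ← smul_add, hσ.anticomm]
    simp [Finset.sum_smul, Finset.smul_sum, smul_smul, ← sq, mul_comm]
  exact smul_right_injective F two_ne_zero h3

lemma inner_cliffMul (hσ : IsCliffordTriple σ) (x : EuclideanSpace ℝ (Fin 3)) (u v : F) :
    inner ℝ (cliffMul σ x u) v = inner ℝ u (cliffMul σ x v) := by
  simp [cliffMul_apply, sum_inner, inner_sum, inner_smul_left, inner_smul_right, hσ.symm]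

lemma norm_cliffMul (hσ : IsCliffordTriple σ) {x : EuclideanSpace ℝ (Fin 3)} (hx : ‖x‖ = 1)
    (u : F) : ‖cliffMul σ x u‖ = ‖u‖ := by
  rw [← sq_eq_sq₀ (norm_nonneg _) (norm_nonneg _), ← real_inner_self_eq_norm_sq,
    inner_cliffMul hσ, cliffMul_cliffMul hσ, hx]
  simp

/-- The pointwise product with Clifford multiplication. -/
def cliffField (σ : Fin 3 → F →L[ℝ] F) (f : EuclideanSpace ℝ (Fin 3) → F)
    (x : EuclideanSpace ℝ (Fin 3)) : F := cliffMul σ x (f x)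

lemma contDiff_cliffMul : ContDiff ℝ ∞ (cliffMul σ) := by
  unfold cliffMul; fun_prop

lemma contDiff_cliffField {f : EuclideanSpace ℝ (Fin 3) → F} (hf : ContDiff ℝ ∞ f) :
    ContDiff ℝ ∞ (cliffField σ f) :=
  contDiff_cliffMul.clm_apply hf

lemma fderiv_cliffField {f : EuclideanSpace ℝ (Fin 3) → F} (hf : ContDiff ℝ ∞ f)
    (x v : EuclideanSpace ℝ (Fin 3)) :
    fderiv ℝ (cliffField σ f) x v = cliffMul σ v (f x) + cliffMul σ x (fderiv ℝ f x v) := by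
  have hf' : DifferentiableAt ℝ f x := hf.differentiable (by simp) x
  have h : HasFDerivAt (cliffMul σ)
      (∑ i, (EuclideanSpace.proj i : EuclideanSpace ℝ (Fin 3) →L[ℝ] ℝ).smulRight (σ i)) x := by
    unfold cliffMul
    refine HasFDerivAt.fun_sum fun i _ => ?_
    exact (EuclideanSpace.proj i : EuclideanSpace ℝ (Fin 3) →L[ℝ] ℝ).hasFDerivAt.smul_const (σ i)
  have h2 := (h.clm_apply hf'.hasFDerivAt).fderiv
  unfold cliffField
  rw [h2]
  simp [cliffMul_apply]
  abel

lemma fderiv_eq_sum (f : EuclideanSpace ℝ (Fin 3) → F) (x v : EuclideanSpace ℝ (Fin 3)) :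
    fderiv ℝ f x v = ∑ i, v i • fderiv ℝ f x (EuclideanSpace.single i 1) := by
  conv_lhs => rw [← (EuclideanSpace.basisFun (Fin 3) ℝ).sum_repr v]
  simp

lemma contDiff_diracOp {f : EuclideanSpace ℝ (Fin 3) → F} (hf : ContDiff ℝ ∞ f) :
    ContDiff ℝ ∞ (diracOp σ f) := by
  have : ContDiff ℝ ∞ (fderiv ℝ f) := hf.fderiv_right (by simp)
  unfold diracOp
  fun_prop

lemma diracOp_cliffField (hσ : IsCliffordTriple σ) {f : EuclideanSpace ℝ (Fin 3) → F}
    (hf : ContDiff ℝ ∞ f) (x : EuclideanSpace ℝ (Fin 3)) :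
    diracOp σ (cliffField σ f) x
      = (3 : ℝ) • f x + (2 : ℝ) • fderiv ℝ f x x - cliffMul σ x (diracOp σ f x) := by
  have hsq : ∀ i u, σ i (σ i u) = u := fun i u => by
    have h := hσ.anticomm i i u
    rw [if_pos rfl, ← two_smul ℝ] at h
    exact smul_right_injective F two_ne_zero h
  have key : ∀ i u, σ i (cliffMul σ x u) = (2 * x i) • u - cliffMul σ x (σ i u) := by
    intro i u
    rw [eq_sub_iff_add_eq, cliffMul_apply, cliffMul_apply, map_sum, ← Finset.sum_add_distrib]
    simp_rw [map_smul, ← smul_add, hσ.anticomm]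
    simp [smul_smul, mul_comm]
  rw [fderiv_eq_sum f x x]
  unfold diracOp
  simp_rw [fderiv_cliffField hf, map_add, key, map_sum, Finset.sum_add_distrib,
    Finset.sum_sub_distrib, Finset.smul_sum, smul_smul]
  have : ∀ i, σ i (cliffMul σ (EuclideanSpace.single i 1) (f x)) = f x := by
    intro i
    simp [cliffMul_apply, hsq]
  simp_rw [this]
  simp only [Finset.sum_const, Finset.card_univ, Fintype.card_fin]
  rw [← Nat.cast_smul_eq_nsmul ℝ]
  push_cast
  abel

/-- Smooth functions satisfying Euler's relation of degree `d`. -/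
def IsEuler (d : ℝ) (f : EuclideanSpace ℝ (Fin 3) → F) : Prop :=
  ContDiff ℝ ∞ f ∧ ∀ x, fderiv ℝ f x x = d • f x

lemma IsEuler.cliffMul_left {d : ℝ} {f : EuclideanSpace ℝ (Fin 3) → F} (hf : IsEuler d f) :
    IsEuler (d + 1) (cliffField σ f) := by
  refine ⟨contDiff_cliffField hf.1, fun x => ?_⟩
  rw [fderiv_cliffField hf.1, hf.2 x]
  simp [cliffField, add_smul, add_comm]

lemma IsEuler.dirac {d : ℝ} {f : EuclideanSpace ℝ (Fin 3) → F} (hf : IsEuler d f) :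
    IsEuler (d - 1) (diracOp σ f) := by
  refine ⟨contDiff_diracOp hf.1, fun x => ?_⟩
  have hC : ContDiff ℝ ∞ (fderiv ℝ f) := hf.1.fderiv_right (by simp)
  have hd : DifferentiableAt ℝ (fderiv ℝ f) x := hC.differentiable (by simp) x
  have hd1 : DifferentiableAt ℝ f x := hf.1.differentiable (by simp) x
  have hsymm : IsSymmSndFDerivAt ℝ f x := hf.1.contDiffAt.isSymmSndFDerivAt
    (by simpa using WithTop.coe_le_coe.2 (le_top : (2 : ℕ∞) ≤ ⊤))
  have h1 : ∀ v, fderiv ℝ (fderiv ℝ f) x x v = (d - 1) • fderiv ℝ f x v := by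
    intro v
    have h2 : HasFDerivAt (fun y => fderiv ℝ f y y) _ x :=
      hd.hasFDerivAt.clm_apply (hasFDerivAt_id x)
    have h3 : HasFDerivAt (fun y => fderiv ℝ f y y) (d • fderiv ℝ f x) x := by
      simp_rw [hf.2]
      exact hd1.hasFDerivAt.const_smul d
    have h4 := congrArg (fun L => L v) (h2.unique h3)
    simp at h4
    rw [hsymm.eq x v, sub_smul, one_smul, ← h4]
    abel
  have h5 : HasFDerivAt (diracOp σ f) (∑ i, (σ i).comp
      ((fderiv ℝ (fderiv ℝ f) x).flip (EuclideanSpace.single i 1))) x := by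
    unfold diracOp
    refine HasFDerivAt.fun_sum fun i _ => ?_
    refine (σ i).hasFDerivAt.comp x ?_
    have := hd.hasFDerivAt.clm_apply (hasFDerivAt_const (EuclideanSpace.single i (1:ℝ)) x)
    convert this using 1
    ext v; simp
  rw [h5.fderiv]
  simp [h1, diracOp, Finset.smul_sum]

lemma IsEuler.eq_zero_of_neg_one {f : EuclideanSpace ℝ (Fin 3) → F} (hf : IsEuler (-1) f)
    (x : EuclideanSpace ℝ (Fin 3)) : f x = 0 := by
  have h : ∀ t : ℝ, HasDerivAt (fun t : ℝ => t • f (t • x)) 0 t := by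
    intro t
    have h1 : HasFDerivAt f (fderiv ℝ f (t • x)) (t • x) :=
      (hf.1.differentiable (by simp) _).hasFDerivAt
    have h2 : HasDerivAt (fun t : ℝ => t • x) x t := by
      simpa using (hasDerivAt_id t).smul_const x
    have h3 := (hasDerivAt_id t).smul (h1.comp_hasDerivAt t h2)
    have h4 := hf.2 (t • x)
    rw [map_smul] at h4
    refine h3.congr_deriv ?_
    simp [h4]
  have := is_const_of_deriv_eq_zero (fun t => (h t).differentiableAt) (fun t => (h t).deriv) 1 0
  simpa using this

end Clifford

section Fischer

variable {F : Type*} [NormedAddCommGroup F] [InnerProductSpace ℝ F] {σ : Fin 3 → F →L[ℝ] F}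

/-- Homogeneous solutions of the Dirac equation. -/
def IsMonogenic (σ : Fin 3 → F →L[ℝ] F) (n : ℕ) (f : EuclideanSpace ℝ (Fin 3) → F) : Prop :=
  IsEuler (n : ℝ) f ∧ ∀ x, diracOp σ f x = 0

lemma IsEuler.iterate_cliffField {d : ℝ} {f : EuclideanSpace ℝ (Fin 3) → F}
    (hf : IsEuler d f) (j : ℕ) : IsEuler (d + j) ((cliffField σ)^[j] f) := by
  induction j with
  | zero => simpa using hf
  | succ j ih =>
    rw [Function.iterate_succ_apply']
    convert ih.cliffMul_left using 1
    push_cast; ring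

lemma IsMonogenic.exists_cliffMul_diracOp (hσ : IsCliffordTriple σ) {n : ℕ}
    {f : EuclideanSpace ℝ (Fin 3) → F} (hf : IsMonogenic σ n f) (j : ℕ) :
    ∃ a : ℝ, a ≤ 2 * (n + j) + 1 ∧ 0 ≤ a ∧ ∀ x,
      cliffMul σ x (diracOp σ ((cliffField σ)^[j] f) x) = a • (cliffField σ)^[j] f x := by
  induction j with
  | zero => exact ⟨0, by positivity, le_rfl, fun x => by simp [hf.2 x]⟩
  | succ j ih =>
    obtain ⟨a, ha, ha0, h⟩ := ih
    refine ⟨3 + 2 * (n + j) - a, by push_cast; linarith, by linarith, fun x => ?_⟩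
    have hE := hf.1.iterate_cliffField (σ := σ) j
    rw [Function.iterate_succ_apply', diracOp_cliffField hσ hE.1, h, hE.2, smul_smul, ← add_smul,
      ← sub_smul, map_smul]
    rfl

lemma IsMonogenic.exists_diracOp_eq_smul (hσ : IsCliffordTriple σ) {n : ℕ}
    {f : EuclideanSpace ℝ (Fin 3) → F} (hf : IsMonogenic σ n f) (j : ℕ) :
    ∃ c : ℝ, 0 < c ∧ ∀ x,
      diracOp σ (cliffField σ ((cliffField σ)^[j] f)) x = c • (cliffField σ)^[j] f x := by
  obtain ⟨a, ha, -, h⟩ := hf.exists_cliffMul_diracOp hσ j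
  have hE := hf.1.iterate_cliffField (σ := σ) j
  refine ⟨3 + 2 * (n + j) - a, by linarith, fun x => ?_⟩
  rw [diracOp_cliffField hσ hE.1, h, hE.2, smul_smul, ← add_smul, ← sub_smul]

/-- The span of the functions `(σ · x) ^ j Ψ` of degree `m`, with `Ψ` monogenic. -/
def fischerSpan (σ : Fin 3 → F →L[ℝ] F) (m : ℕ) : Submodule ℝ (EuclideanSpace ℝ (Fin 3) → F) :=
  Submodule.span ℝ {g | ∃ n j f, n + j = m ∧ IsMonogenic σ n f ∧ g = (cliffField σ)^[j] f}

lemma diracOp_add {f g : EuclideanSpace ℝ (Fin 3) → F} (hf : ContDiff ℝ ∞ f)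
    (hg : ContDiff ℝ ∞ g) : diracOp σ (f + g) = diracOp σ f + diracOp σ g := by
  ext x
  simp [diracOp, fderiv_add (hf.differentiable (by simp) x) (hg.differentiable (by simp) x),
    Finset.sum_add_distrib]

lemma diracOp_smul (c : ℝ) {f : EuclideanSpace ℝ (Fin 3) → F} (hf : ContDiff ℝ ∞ f) :
    diracOp σ (c • f) = c • diracOp σ f := by
  ext x
  simp [diracOp, fderiv_const_smul (hf.differentiable (by simp) x), Finset.smul_sum]

lemma IsEuler.add {d : ℝ} {f g : EuclideanSpace ℝ (Fin 3) → F} (hf : IsEuler d f)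
    (hg : IsEuler d g) : IsEuler d (f + g) := by
  refine ⟨hf.1.add hg.1, fun x => ?_⟩
  simp [fderiv_add (hf.1.differentiable (by simp) x) (hg.1.differentiable (by simp) x), hf.2,
    hg.2]

lemma IsEuler.smul {d : ℝ} {f : EuclideanSpace ℝ (Fin 3) → F} (hf : IsEuler d f) (c : ℝ) :
    IsEuler d (c • f) := by
  refine ⟨contDiff_const.smul hf.1, fun x => ?_⟩
  simp [fderiv_const_smul (hf.1.differentiable (by simp) x), hf.2, smul_comm c d]

lemma cliffField_add (f g : EuclideanSpace ℝ (Fin 3) → F) :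
    cliffField σ (f + g) = cliffField σ f + cliffField σ g := by
  ext x; simp [cliffField]

lemma cliffField_smul (c : ℝ) (f : EuclideanSpace ℝ (Fin 3) → F) :
    cliffField σ (c • f) = c • cliffField σ f := by
  ext x; simp [cliffField]

lemma exists_diracOp_cliffField_eq (hσ : IsCliffordTriple σ) {m : ℕ}
    {g : EuclideanSpace ℝ (Fin 3) → F} (hg : g ∈ fischerSpan σ m) :
    ∃ q, IsEuler (m : ℝ) q ∧ cliffField σ q ∈ fischerSpan σ (m + 1) ∧
      diracOp σ (cliffField σ q) = g := by
  induction hg using Submodule.span_induction with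
  | mem g hg =>
    obtain ⟨n, j, f, rfl, hf, rfl⟩ := hg
    obtain ⟨c, hc, h⟩ := hf.exists_diracOp_eq_smul hσ j
    have hE := hf.1.iterate_cliffField (σ := σ) j
    refine ⟨c⁻¹ • (cliffField σ)^[j] f, by simpa using hE.smul c⁻¹, ?_, ?_⟩
    · rw [cliffField_smul]
      refine Submodule.smul_mem _ _ (Submodule.subset_span ⟨n, j + 1, f, by ring, hf, ?_⟩)
      rw [Function.iterate_succ_apply']
    · rw [cliffField_smul, diracOp_smul _ (contDiff_cliffField hE.1)]
      ext x
      simp [h, smul_smul, hc.ne']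
  | zero =>
    have h0 : cliffField σ (0 : EuclideanSpace ℝ (Fin 3) → F) = 0 := by
      ext x; simp [cliffField]
    refine ⟨0, ⟨contDiff_const, by simp⟩, by rw [h0]; exact Submodule.zero_mem _, ?_⟩
    rw [h0]; ext x; simp [diracOp]
  | add g₁ g₂ _ _ h₁ h₂ =>
    obtain ⟨q₁, hE₁, hq₁, rfl⟩ := h₁
    obtain ⟨q₂, hE₂, hq₂, rfl⟩ := h₂
    refine ⟨q₁ + q₂, hE₁.add hE₂, ?_, ?_⟩
    · rw [cliffField_add]; exact Submodule.add_mem _ hq₁ hq₂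
    · rw [cliffField_add, diracOp_add (contDiff_cliffField hE₁.1) (contDiff_cliffField hE₂.1)]
  | smul c g _ h =>
    obtain ⟨q, hE, hq, rfl⟩ := h
    refine ⟨c • q, hE.smul c, ?_, ?_⟩
    · rw [cliffField_smul]; exact Submodule.smul_mem _ _ hq
    · rw [cliffField_smul, diracOp_smul _ (contDiff_cliffField hE.1)]

/-- Fischer decomposition of smooth homogeneous functions. -/
lemma IsEuler.mem_fischerSpan (hσ : IsCliffordTriple σ) (m : ℕ)
    {f : EuclideanSpace ℝ (Fin 3) → F} (hf : IsEuler (m : ℝ) f) : f ∈ fischerSpan σ m := by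
  induction m generalizing f with
  | zero =>
    refine Submodule.subset_span ⟨0, 0, f, rfl, ⟨hf, fun x => ?_⟩, rfl⟩
    exact IsEuler.eq_zero_of_neg_one (by simpa using hf.dirac (σ := σ)) x
  | succ m ih =>
    obtain ⟨q, hE, hq, h⟩ := exists_diracOp_cliffField_eq hσ
      (ih (by simpa using hf.dirac (σ := σ)))
    have hE' : IsEuler ((m + 1 : ℕ) : ℝ) (cliffField σ q) := by simpa using hE.cliffMul_left
    have hmon : IsMonogenic σ (m + 1) (f + (-1 : ℝ) • cliffField σ q) := by
      refine ⟨hf.add (hE'.smul _), fun x => ?_⟩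
      rw [diracOp_add hf.1 (hE'.smul _).1, diracOp_smul _ hE'.1, h]
      simp
    have hmem : f + (-1 : ℝ) • cliffField σ q ∈ fischerSpan σ (m + 1) :=
      Submodule.subset_span ⟨m + 1, 0, _, rfl, hmon, rfl⟩
    simpa using Submodule.add_mem _ hmem hq

/-- Smooth eigenfunctions of the spin-orbit operator. -/
def IsSpinOrbitEigen (σ : Fin 3 → F →L[ℝ] F) (k : ℝ) (f : EuclideanSpace ℝ (Fin 3) → F) : Prop :=
  ContDiff ℝ ∞ f ∧ ∀ x, spinOrbit σ f x = k • f x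

lemma IsMonogenic.isSpinOrbitEigen {n : ℕ} {f : EuclideanSpace ℝ (Fin 3) → F}
    (hf : IsMonogenic σ n f) : IsSpinOrbitEigen σ n f :=
  ⟨hf.1.1, fun x => by simp [spinOrbit, hf.2, hf.1.2]⟩

lemma IsMonogenic.isSpinOrbitEigen_cliffField (hσ : IsCliffordTriple σ) {n : ℕ}
    {f : EuclideanSpace ℝ (Fin 3) → F} (hf : IsMonogenic σ n f) :
    IsSpinOrbitEigen σ (-(n + 2)) (cliffField σ f) := by
  have hE := hf.1.cliffMul_left (σ := σ)
  refine ⟨hE.1, fun x => ?_⟩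
  rw [spinOrbit, hE.2, diracOp_cliffField hσ hf.1.1, hf.2, hf.1.2, map_zero, sub_zero, smul_smul,
    ← add_smul, map_smul, cliffField, ← sub_smul]
  congr 1; ring

lemma exists_isSpinOrbitEigen_eq_iterate (hσ : IsCliffordTriple σ) {n : ℕ}
    {f : EuclideanSpace ℝ (Fin 3) → F} (hf : IsMonogenic σ n f) (j : ℕ) :
    ∃ k g, 0 ≤ k * (k + 2) ∧ IsSpinOrbitEigen σ k g ∧
      ∀ x, ‖x‖ = 1 → (cliffField σ)^[j] f x = g x := by
  induction j using Nat.twoStepInduction with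
  | zero => exact ⟨n, f, by positivity, hf.isSpinOrbitEigen, fun x _ => rfl⟩
  | one =>
    exact ⟨_, _, by ring_nf; positivity, hf.isSpinOrbitEigen_cliffField hσ, fun x _ => rfl⟩
  | more j ih _ =>
    obtain ⟨k, g, hk, hg, h⟩ := ih
    refine ⟨k, g, hk, hg, fun x hx => ?_⟩
    rw [Function.iterate_succ_apply', Function.iterate_succ_apply', cliffField, cliffField,
      cliffMul_cliffMul hσ, hx, ← h x hx]
    simp

/-- The span of the restrictions to the sphere of the spin-orbit eigenfunctions whose
eigenvalue `k` satisfies `|k + 1| ≥ 1`. -/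
def eigenSpan (σ : Fin 3 → F →L[ℝ] F) :
    Submodule ℝ (Metric.sphere (0 : EuclideanSpace ℝ (Fin 3)) 1 → F) :=
  Submodule.span ℝ {u | ∃ k f, 0 ≤ k * (k + 2) ∧ IsSpinOrbitEigen σ k f ∧ u = fun y => f y.1}

lemma IsEuler.restrict_mem_eigenSpan (hσ : IsCliffordTriple σ) {m : ℕ}
    {f : EuclideanSpace ℝ (Fin 3) → F} (hf : IsEuler (m : ℝ) f) :
    (fun y : Metric.sphere (0 : EuclideanSpace ℝ (Fin 3)) 1 => f y) ∈ eigenSpan σ := by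
  have h := hf.mem_fischerSpan hσ
  clear hf
  induction h using Submodule.span_induction with
  | mem g hg =>
    obtain ⟨n, j, f, -, hf, rfl⟩ := hg
    obtain ⟨k, g, hk, hg, h⟩ := exists_isSpinOrbitEigen_eq_iterate hσ hf j
    exact Submodule.subset_span ⟨k, g, hk, hg, funext fun y => h y (norm_eq_of_mem_sphere y)⟩
  | zero => exact Submodule.zero_mem _
  | add g₁ g₂ _ _ h₁ h₂ => exact Submodule.add_mem _ h₁ h₂
  | smul c g _ h => exact Submodule.smul_mem _ c h

end Fischer

section Approximation

/-- Smooth homogeneous functions of degree `m`. -/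
def IsSmoothHomogeneous {F : Type*} [NormedAddCommGroup F] [NormedSpace ℝ F] (m : ℕ)
    (f : EuclideanSpace ℝ (Fin 3) → F) : Prop :=
  ContDiff ℝ ∞ f ∧ ∀ (r : ℝ) x, f (r • x) = r ^ m • f x

variable {F : Type*} [NormedAddCommGroup F] [InnerProductSpace ℝ F] {σ : Fin 3 → F →L[ℝ] F}

lemma IsSmoothHomogeneous.isEuler {m : ℕ} {f : EuclideanSpace ℝ (Fin 3) → F}
    (hf : IsSmoothHomogeneous m f) : IsEuler (m : ℝ) f := by
  refine ⟨hf.1, fun x => ?_⟩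
  have h1 : HasFDerivAt f (fderiv ℝ f x) ((1 : ℝ) • x) := by
    rw [one_smul]; exact (hf.1.differentiable (by simp) x).hasFDerivAt
  have h2 : HasDerivAt (fun t : ℝ => t • x) x 1 := by
    simpa using (hasDerivAt_id (1 : ℝ)).smul_const x
  have h3 : HasDerivAt (fun t : ℝ => f (t • x)) (fderiv ℝ f x x) 1 :=
    h1.comp_hasDerivAt (1 : ℝ) h2
  have h4 : HasDerivAt (fun t : ℝ => f (t • x)) ((m : ℝ) • f x) 1 := by
    simp_rw [hf.2]
    simpa using (hasDerivAt_pow m (1 : ℝ)).smul_const (f x)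
  exact h3.unique h4

/-- The span of the smooth homogeneous functions. -/
def homogeneousSpan (F : Type*) [NormedAddCommGroup F] [NormedSpace ℝ F] :
    Submodule ℝ (EuclideanSpace ℝ (Fin 3) → F) :=
  Submodule.span ℝ {f | ∃ m, IsSmoothHomogeneous m f}

lemma exists_finset_eigen_of_mem_homogeneousSpan (hσ : IsCliffordTriple σ)
    {p : EuclideanSpace ℝ (Fin 3) → F} (hp : p ∈ homogeneousSpan F) :
    ∃ t : Finset (Metric.sphere (0 : EuclideanSpace ℝ (Fin 3)) 1 → F),
      (∀ u ∈ t, ∃ k f, 0 ≤ k * (k + 2) ∧ IsSpinOrbitEigen σ k f ∧ u = fun y => f y.1) ∧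
      ∀ r : ℝ, (fun y : Metric.sphere (0 : EuclideanSpace ℝ (Fin 3)) 1 => p (r • y.1)) ∈
        Submodule.span ℝ (t : Set (Metric.sphere (0 : EuclideanSpace ℝ (Fin 3)) 1 → F)) := by
  classical
  induction hp using Submodule.span_induction with
  | mem g hg =>
    obtain ⟨m, hg⟩ := hg
    obtain ⟨t, ht, hgt⟩ := Submodule.mem_span_finite_of_mem_span
      (hg.isEuler.restrict_mem_eigenSpan hσ)
    refine ⟨t, fun u hu => ht hu, fun r => ?_⟩
    simp_rw [hg.2]
    exact Submodule.smul_mem _ (r ^ m) hgt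
  | zero => exact ⟨∅, by simp, fun r => Submodule.zero_mem _⟩
  | add g₁ g₂ _ _ h₁ h₂ =>
    obtain ⟨t₁, ht₁, h₁⟩ := h₁
    obtain ⟨t₂, ht₂, h₂⟩ := h₂
    refine ⟨t₁ ∪ t₂, fun u hu => ?_, fun r => ?_⟩
    · rcases Finset.mem_union.1 hu with h | h
      exacts [ht₁ u h, ht₂ u h]
    · exact Submodule.add_mem _ (Submodule.span_mono (by simp) (h₁ r))
        (Submodule.span_mono (by simp) (h₂ r))
  | smul c g _ h =>
    obtain ⟨t, ht, h⟩ := h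
    exact ⟨t, ht, fun r => Submodule.smul_mem _ c (h r)⟩

/-- The algebra of polynomial functions on `ℝ³`. -/
def polyAlgebra : Subalgebra ℝ C(EuclideanSpace ℝ (Fin 3), ℝ) :=
  Algebra.adjoin ℝ (Set.range fun i : Fin 3 => (⟨fun x => x i, by fun_prop⟩ : C(_, ℝ)))

lemma coe_mem_homogeneousSpan_of_mem_polyAlgebra {a : C(EuclideanSpace ℝ (Fin 3), ℝ)}
    (ha : a ∈ polyAlgebra) (v : F) : (fun x => a x • v) ∈ homogeneousSpan F := by
  rw [polyAlgebra, ← Subalgebra.mem_toSubmodule, Algebra.adjoin_eq_span] at ha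
  induction ha using Submodule.span_induction with
  | mem a ha =>
    have h : ∃ m, IsSmoothHomogeneous m (fun x => a x) := by
      induction ha using Submonoid.closure_induction with
      | mem a ha =>
        obtain ⟨i, rfl⟩ := ha
        refine ⟨1, ?_, by simp⟩
        simp only [ContinuousMap.coe_mk]
        fun_prop
      | one => exact ⟨0, contDiff_const, by simp⟩
      | mul a b _ _ ha hb =>
        obtain ⟨m, ha⟩ := ha
        obtain ⟨n, hb⟩ := hb
        refine ⟨m + n, ha.1.mul hb.1, fun r x => ?_⟩
        have h1 := ha.2 r x
        have h2 := hb.2 r x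
        simp only [smul_eq_mul] at h1 h2
        simp only [ContinuousMap.coe_mul, Pi.mul_apply, h1, h2, smul_eq_mul]
        ring
    obtain ⟨m, h⟩ := h
    refine Submodule.subset_span ⟨m, h.1.smul contDiff_const, fun r x => ?_⟩
    have := h.2 r x
    simp only at this ⊢
    rw [this, smul_assoc]
  | zero => simp only [ContinuousMap.zero_apply, zero_smul]; exact Submodule.zero_mem _
  | add a b _ _ ha hb => simp only [ContinuousMap.add_apply, add_smul]; exact add_mem ha hb
  | smul c a _ ha =>
    simp only [ContinuousMap.smul_apply, smul_assoc]
    exact Submodule.smul_mem _ c ha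

lemma polyAlgebra_separatesPoints : polyAlgebra.SeparatesPoints := by
  intro x y hxy
  have : ∃ i, x i ≠ y i := by
    by_contra! h
    exact hxy (by ext i; exact h i)
  obtain ⟨i, hi⟩ := this
  exact ⟨_, ⟨⟨fun x => x i, by fun_prop⟩, Algebra.subset_adjoin ⟨i, rfl⟩, rfl⟩, hi⟩

lemma exists_mem_homogeneousSpan_near [FiniteDimensional ℝ F] {f : EuclideanSpace ℝ (Fin 3) → F}
    (hf : Continuous f) (R : ℝ) {ε : ℝ} (hε : 0 < ε) :
    ∃ p ∈ homogeneousSpan F, ∀ x, ‖x‖ ≤ R → ‖f x - p x‖ ≤ ε := by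
  let b := stdOrthonormalBasis ℝ F
  set n := Module.finrank ℝ F
  have hδ : 0 < ε / (n + 1) := by positivity
  have h : ∀ i : Fin n, ∃ a ∈ polyAlgebra, ∀ x, ‖x‖ ≤ R →
      ‖a x - inner ℝ (b i) (f x)‖ < ε / (n + 1) := by
    intro i
    obtain ⟨g, hg, h⟩ :=
      ContinuousMap.exists_mem_subalgebra_near_continuous_of_isCompact_of_separatesPoints
      polyAlgebra_separatesPoints ⟨fun x => inner ℝ (b i) (f x), by fun_prop⟩
      (isCompact_closedBall (0 : EuclideanSpace ℝ (Fin 3)) R) hδ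
    exact ⟨g, hg, fun x hx => h x (by simpa using hx)⟩
  choose a ha h using h
  refine ⟨∑ i, fun x => a i x • b i, Submodule.sum_mem _ fun i _ =>
    coe_mem_homogeneousSpan_of_mem_polyAlgebra (ha i) _, fun x hx => ?_⟩
  have h1 : f x = ∑ i, inner ℝ (b i) (f x) • b i := (b.sum_repr' (f x)).symm
  calc ‖f x - (∑ i, fun x => a i x • b i) x‖
      = ‖∑ i, (inner ℝ (b i) (f x) - a i x) • b i‖ := by
        conv_lhs => rw [h1]
        rw [Finset.sum_apply, ← Finset.sum_sub_distrib]
        simp_rw [sub_smul]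
    _ ≤ ∑ i : Fin n, ε / (n + 1) := by
        refine norm_sum_le_of_le _ fun i _ => ?_
        rw [norm_smul, b.norm_eq_one, mul_one, norm_sub_rev]
        exact (h i x hx).le
    _ ≤ ε := by
        simp only [Finset.sum_const, Finset.card_univ, Fintype.card_fin, nsmul_eq_mul]
        rw [mul_div_assoc', div_le_iff₀ (by positivity)]
        nlinarith

end Approximation

section Sphere

open Metric

lemma hasDerivAt_integral_of_continuous {X : Type*} [TopologicalSpace X] [CompactSpace X]
    [MeasurableSpace X] [OpensMeasurableSpace X] [SecondCountableTopology X]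
    {μ : Measure X} [IsFiniteMeasure μ] {G G' : ℝ → X → ℝ} (hG : ∀ t, Continuous (G t))
    (hG' : Continuous (Function.uncurry G')) (h : ∀ t y, HasDerivAt (G · y) (G' t y) t) (t : ℝ) :
    HasDerivAt (fun t => ∫ y, G t y ∂μ) (∫ y, G' t y ∂μ) t := by
  have hK : IsCompact (Set.Icc (t - 1) (t + 1) ×ˢ (Set.univ : Set X)) :=
    isCompact_Icc.prod isCompact_univ
  obtain ⟨C, hC⟩ := hK.exists_bound_of_continuousOn hG'.continuousOn
  have hG'2 : ∀ t, Continuous (G' t) := fun t => hG'.comp (by fun_prop : Continuous fun y => (t, y))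
  refine (hasDerivAt_integral_of_dominated_loc_of_deriv_le (bound := fun _ => C)
    (s := Set.Icc (t - 1) (t + 1)) (Icc_mem_nhds (by linarith) (by linarith))
    (.of_forall fun s => (hG s).aestronglyMeasurable) ?_ (hG'2 t).aestronglyMeasurable
    (.of_forall fun y s hs => hC (s, y) ⟨hs, trivial⟩) (integrable_const _)
    (.of_forall fun y s _ => h s y)).2
  exact (hG t).integrable_of_hasCompactSupport (HasCompactSupport.of_compactSpace _)

/-- The action of a linear isometry on the unit sphere. -/
def sphereMap (e : EuclideanSpace ℝ (Fin 3) ≃ₗᵢ[ℝ] EuclideanSpace ℝ (Fin 3))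
    (y : sphere (0 : EuclideanSpace ℝ (Fin 3)) 1) : sphere (0 : EuclideanSpace ℝ (Fin 3)) 1 :=
  ⟨e y, by simp⟩

lemma measurePreserving_sphereMap
    (e : EuclideanSpace ℝ (Fin 3) ≃ₗᵢ[ℝ] EuclideanSpace ℝ (Fin 3)) :
    MeasurePreserving (sphereMap e) (volume : Measure (EuclideanSpace ℝ (Fin 3))).toSphere
      (volume : Measure (EuclideanSpace ℝ (Fin 3))).toSphere := by
  have hm : Measurable (sphereMap e) := by
    unfold sphereMap
    have : Continuous e := e.continuous
    fun_prop
  refine ⟨hm, ?_⟩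
  ext s hs
  rw [Measure.map_apply hm hs, Measure.toSphere_apply' _ hs, Measure.toSphere_apply' _ (hm hs)]
  congr 1
  symm
  rw [← e.measurePreserving.measure_preimage_equiv (f := e.toMeasurableEquiv)]
  congr 1
  ext x
  simp only [Set.mem_smul, Set.mem_image, Set.mem_preimage]
  constructor
  · rintro ⟨r, hr, _, ⟨y, hy, rfl⟩, h⟩
    refine ⟨r, hr, e.symm y, ⟨sphereMap e.symm y, ?_, rfl⟩, ?_⟩
    · convert hy
      ext1; simp [sphereMap]
    · rw [← map_smul, h]; exact e.symm_apply_apply x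
  · rintro ⟨r, hr, _, ⟨y, hy, rfl⟩, rfl⟩
    exact ⟨r, hr, e y, ⟨sphereMap e y, hy, rfl⟩, (map_smul e r y.1).symm⟩

/-- The rotation by the angle `t` in the coordinate plane `(i, j)`, as a linear map. -/
def planeRotation (i j : Fin 3) (t : ℝ) (x : EuclideanSpace ℝ (Fin 3)) :
    EuclideanSpace ℝ (Fin 3) :=
  x + ((Real.cos t - 1) * x i - Real.sin t * x j) • EuclideanSpace.single i 1 +
    ((Real.cos t - 1) * x j + Real.sin t * x i) • EuclideanSpace.single j 1

lemma norm_planeRotation {i j : Fin 3} (hij : i ≠ j) (t : ℝ) (x : EuclideanSpace ℝ (Fin 3)) :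
    ‖planeRotation i j t x‖ = ‖x‖ := by
  rw [← sq_eq_sq₀ (norm_nonneg _) (norm_nonneg _), EuclideanSpace.norm_sq_eq,
    EuclideanSpace.norm_sq_eq]
  have h := Real.sin_sq_add_cos_sq t
  unfold planeRotation
  generalize Real.sin t = s at h ⊢
  generalize Real.cos t = c at h ⊢
  fin_cases i <;> fin_cases j <;> simp [Fin.sum_univ_three] at hij ⊢ <;>
    first
    | linear_combination (x 0 ^ 2 + x 1 ^ 2) * h
    | linear_combination (x 0 ^ 2 + x 2 ^ 2) * h
    | linear_combination (x 1 ^ 2 + x 2 ^ 2) * h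

/-- The rotation by the angle `t` in the coordinate plane `(i, j)`. -/
def planeRotationEquiv {i j : Fin 3} (hij : i ≠ j) (t : ℝ) :
    EuclideanSpace ℝ (Fin 3) ≃ₗᵢ[ℝ] EuclideanSpace ℝ (Fin 3) :=
  LinearIsometry.toLinearIsometryEquiv
    { toFun := planeRotation i j t
      map_add' := fun x y => by
        simp only [planeRotation, PiLp.add_apply]; module
      map_smul' := fun r x => by
        simp only [planeRotation, PiLp.smul_apply, smul_eq_mul, RingHom.id_apply]; module
      norm_map' := norm_planeRotation hij t } rfl

lemma integral_sphere_fderiv_rotation {g : EuclideanSpace ℝ (Fin 3) → ℝ} (hg : ContDiff ℝ ∞ g)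
    (i j : Fin 3) :
    ∫ y : sphere (0 : EuclideanSpace ℝ (Fin 3)) 1,
      fderiv ℝ g y (y.1 i • EuclideanSpace.single j 1 - y.1 j • EuclideanSpace.single i 1)
        ∂(volume : Measure (EuclideanSpace ℝ (Fin 3))).toSphere = 0 := by
  rcases eq_or_ne i j with rfl | hij
  · simp
  set μ := (volume : Measure (EuclideanSpace ℝ (Fin 3))).toSphere
  let v : ℝ → EuclideanSpace ℝ (Fin 3) → EuclideanSpace ℝ (Fin 3) := fun t x =>
    (-Real.sin t * x i - Real.cos t * x j) • EuclideanSpace.single i 1 +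
      (-Real.sin t * x j + Real.cos t * x i) • EuclideanSpace.single j 1
  have hrot : ∀ t x, HasDerivAt (fun t => planeRotation i j t x) (v t x) t := by
    intro t x
    have hc := (Real.hasDerivAt_cos t).sub_const 1
    have hs := Real.hasDerivAt_sin t
    exact ((((hc.mul_const (x i)).sub (hs.mul_const (x j))).smul_const _).const_add x).add
      (((hc.mul_const (x j)).add (hs.mul_const (x i))).smul_const _)
  have hcont : Continuous fun p : ℝ × EuclideanSpace ℝ (Fin 3) => planeRotation i j p.1 p.2 := by
    unfold planeRotation; fun_prop
  have hgc : Continuous (fderiv ℝ g) := hg.continuous_fderiv (by simp)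
  have hG : HasDerivAt (fun t => ∫ y : sphere (0 : EuclideanSpace ℝ (Fin 3)) 1,
      g (planeRotation i j t y) ∂μ) (∫ y : sphere (0 : EuclideanSpace ℝ (Fin 3)) 1,
      fderiv ℝ g (planeRotation i j 0 y) (v 0 y) ∂μ) 0 := by
    refine hasDerivAt_integral_of_continuous 
      (G := fun t (y : sphere (0 : EuclideanSpace ℝ (Fin 3)) 1) => g (planeRotation i j t y))
      (G' := fun t y => fderiv ℝ g (planeRotation i j t y) (v t y)) (fun t => ?_) ?_ ?_ 0
    · exact hg.continuous.comp (hcont.comp (by fun_prop :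
        Continuous fun y : sphere (0 : EuclideanSpace ℝ (Fin 3)) 1 => (t, y.1)))
    · have h1 : Continuous fun p : ℝ × sphere (0 : EuclideanSpace ℝ (Fin 3)) 1 =>
          planeRotation i j p.1 p.2.1 := hcont.comp (by fun_prop :
        Continuous fun p : ℝ × sphere (0 : EuclideanSpace ℝ (Fin 3)) 1 => (p.1, p.2.1))
      have h2 : Continuous fun p : ℝ × sphere (0 : EuclideanSpace ℝ (Fin 3)) 1 => v p.1 p.2.1 := by
        simp only [v]; fun_prop
      exact (hgc.comp h1).clm_apply h2
    · exact fun t y => ((hg.differentiable (by simp) _).hasFDerivAt).comp_hasDerivAt t (hrot t y)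
  have hconst : ∀ t, ∫ y : sphere (0 : EuclideanSpace ℝ (Fin 3)) 1,
      g (planeRotation i j t y) ∂μ = ∫ y : sphere (0 : EuclideanSpace ℝ (Fin 3)) 1, g y ∂μ := by
    intro t
    have hmp : MeasurePreserving (sphereMap (planeRotationEquiv hij t)) μ μ :=
      measurePreserving_sphereMap _
    have hc : Continuous fun y : sphere (0 : EuclideanSpace ℝ (Fin 3)) 1 => g y :=
      hg.continuous.comp continuous_subtype_val
    have h1 := integral_map (μ := μ) hmp.measurable.aemeasurable
      (f := fun y : sphere (0 : EuclideanSpace ℝ (Fin 3)) 1 => g y) hc.aestronglyMeasurable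
    rw [hmp.map_eq] at h1
    exact h1.symm
  simp_rw [hconst] at hG
  have h0 := hG.unique (hasDerivAt_const _ _)
  rw [← h0]
  congr 1
  ext y
  have h1 : planeRotation i j 0 y.1 = y.1 := by simp [planeRotation]
  rw [h1]
  congr 1
  simp [v]
  abel

end Sphere

section Symmetry

open Metric

variable {F : Type*} [NormedAddCommGroup F] [InnerProductSpace ℝ F] {σ : Fin 3 → F →L[ℝ] F}

lemma integrable_sphere_of_continuous {H : Type*} [NormedAddCommGroup H]
    {u : sphere (0 : EuclideanSpace ℝ (Fin 3)) 1 → H} (hu : Continuous u) :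
    Integrable u (volume : Measure (EuclideanSpace ℝ (Fin 3))).toSphere :=
  hu.integrable_of_hasCompactSupport (HasCompactSupport.of_compactSpace _)

lemma spinOrbit_eq_sum (hσ : IsCliffordTriple σ) (f : EuclideanSpace ℝ (Fin 3) → F)
    (x : EuclideanSpace ℝ (Fin 3)) :
    spinOrbit σ f x = -(1 / 2 : ℝ) • ∑ i, ∑ j, σ i (σ j (fderiv ℝ f x
      (x i • EuclideanSpace.single j 1 - x j • EuclideanSpace.single i 1))) := by
  have h1 : cliffMul σ x (diracOp σ f x) =
      ∑ i, ∑ j, x i • σ i (σ j (fderiv ℝ f x (EuclideanSpace.single j 1))) := by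
    simp_rw [cliffMul_apply, diracOp, map_sum, Finset.smul_sum]
  have h2 : (2 : ℝ) • fderiv ℝ f x x - cliffMul σ x (diracOp σ f x) =
      ∑ i, ∑ j, x j • σ i (σ j (fderiv ℝ f x (EuclideanSpace.single i 1))) := by
    rw [sub_eq_iff_eq_add, h1, Finset.sum_comm, ← Finset.sum_add_distrib]
    simp_rw [← Finset.sum_add_distrib, ← smul_add, hσ.anticomm]
    rw [fderiv_eq_sum f x x]
    simp [Finset.smul_sum, smul_smul, mul_comm]
  have h3 : ∑ i, ∑ j, σ i (σ j (fderiv ℝ f x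
      (x i • EuclideanSpace.single j 1 - x j • EuclideanSpace.single i 1))) =
      cliffMul σ x (diracOp σ f x) -
        ((2 : ℝ) • fderiv ℝ f x x - cliffMul σ x (diracOp σ f x)) := by
    rw [h2, h1]
    simp_rw [map_sub, map_smul, Finset.sum_sub_distrib]
  rw [h3, spinOrbit]
  module

lemma contDiff_spinOrbit {f : EuclideanSpace ℝ (Fin 3) → F} (hf : ContDiff ℝ ∞ f) :
    ContDiff ℝ ∞ (spinOrbit σ f) :=
  ((hf.fderiv_right (by simp)).clm_apply contDiff_id).sub
    (contDiff_cliffMul.clm_apply (contDiff_diracOp hf))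

lemma inner_spinOrbit_sub (hσ : IsCliffordTriple σ) {f h : EuclideanSpace ℝ (Fin 3) → F}
    (hf : ContDiff ℝ ∞ f) (hh : ContDiff ℝ ∞ h) (x : EuclideanSpace ℝ (Fin 3)) :
    inner ℝ (spinOrbit σ f x) (h x) - inner ℝ (f x) (spinOrbit σ h x) =
      ∑ i, ∑ j, -(1 / 2 : ℝ) * fderiv ℝ (fun x => inner ℝ (f x) (σ j (σ i (h x)))) x
        (x i • EuclideanSpace.single j 1 - x j • EuclideanSpace.single i 1) := by
  have hd : ∀ i j v, fderiv ℝ (fun x => inner ℝ (f x) (σ j (σ i (h x)))) x v =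
      inner ℝ (fderiv ℝ f x v) (σ j (σ i (h x))) +
        inner ℝ (f x) (σ j (σ i (fderiv ℝ h x v))) := by
    intro i j v
    have hf' := hf.differentiable (by simp) x
    have hh' := hh.differentiable (by simp) x
    have h1 : HasFDerivAt (fun x => σ j (σ i (h x))) (((σ j).comp (σ i)).comp (fderiv ℝ h x)) x :=
      ((σ j).comp (σ i)).hasFDerivAt.comp x hh'.hasFDerivAt
    rw [fderiv_inner_apply ℝ hf' h1.differentiableAt, h1.fderiv, add_comm]
    rfl
  have hswap : ∑ i, ∑ j, inner ℝ (f x) (σ i (σ j (fderiv ℝ h x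
      (x i • EuclideanSpace.single j 1 - x j • EuclideanSpace.single i 1)))) =
      -∑ i, ∑ j, inner ℝ (f x) (σ j (σ i (fderiv ℝ h x
      (x i • EuclideanSpace.single j 1 - x j • EuclideanSpace.single i 1)))) := by
    rw [Finset.sum_comm, ← Finset.sum_neg_distrib]
    refine Finset.sum_congr rfl fun i _ => ?_
    rw [← Finset.sum_neg_distrib]
    refine Finset.sum_congr rfl fun j _ => ?_
    rw [← inner_neg_right, ← map_neg, ← map_neg, ← map_neg, neg_sub]
  simp_rw [hd, mul_add, Finset.sum_add_distrib, ← Finset.mul_sum]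
  rw [spinOrbit_eq_sum hσ, spinOrbit_eq_sum hσ, inner_smul_left, inner_smul_right]
  simp_rw [sum_inner, inner_sum, hσ.symm]
  rw [hswap]
  simp
  ring

lemma integral_inner_spinOrbit (hσ : IsCliffordTriple σ) {f h : EuclideanSpace ℝ (Fin 3) → F}
    (hf : ContDiff ℝ ∞ f) (hh : ContDiff ℝ ∞ h) :
    ∫ y : sphere (0 : EuclideanSpace ℝ (Fin 3)) 1, inner ℝ (spinOrbit σ f y) (h y)
        ∂(volume : Measure (EuclideanSpace ℝ (Fin 3))).toSphere =
      ∫ y : sphere (0 : EuclideanSpace ℝ (Fin 3)) 1, inner ℝ (f y) (spinOrbit σ h y)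
        ∂(volume : Measure (EuclideanSpace ℝ (Fin 3))).toSphere := by
  have hcont : ∀ {g : EuclideanSpace ℝ (Fin 3) → F}, ContDiff ℝ ∞ g →
      Continuous fun y : sphere (0 : EuclideanSpace ℝ (Fin 3)) 1 => g y :=
    fun hg => hg.continuous.comp continuous_subtype_val
  rw [← sub_eq_zero, ← integral_sub
    (integrable_sphere_of_continuous ((hcont (contDiff_spinOrbit hf)).inner (hcont hh)))
    (integrable_sphere_of_continuous ((hcont hf).inner (hcont (contDiff_spinOrbit hh))))]
  simp_rw [inner_spinOrbit_sub hσ hf hh]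
  have hsm : ∀ i j, ContDiff ℝ ∞ (fun x => inner ℝ (f x) (σ j (σ i (h x)))) := by
    intro i j
    exact hf.inner ℝ ((σ j).contDiff.comp ((σ i).contDiff.comp hh))
  have hint : ∀ i j, Integrable (fun y : sphere (0 : EuclideanSpace ℝ (Fin 3)) 1 =>
      -(1 / 2 : ℝ) * fderiv ℝ (fun x => inner ℝ (f x) (σ j (σ i (h x)))) y
        (y.1 i • EuclideanSpace.single j 1 - y.1 j • EuclideanSpace.single i 1))
      (volume : Measure (EuclideanSpace ℝ (Fin 3))).toSphere := by
    intro i j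
    refine integrable_sphere_of_continuous (continuous_const.mul ?_)
    exact (((hsm i j).continuous_fderiv (by simp)).comp continuous_subtype_val).clm_apply
      (by fun_prop)
  rw [integral_finsetSum _ fun i _ => integrable_finsetSum _ fun j _ => hint i j]
  refine Finset.sum_eq_zero fun i _ => ?_
  rw [integral_finsetSum _ fun j _ => hint i j]
  refine Finset.sum_eq_zero fun j _ => ?_
  rw [integral_const_mul, integral_sphere_fderiv_rotation (hsm i j), mul_zero]

end Symmetry

section Eigenbasis

open Metric

variable {F : Type*} [NormedAddCommGroup F] [InnerProductSpace ℝ F] {σ : Fin 3 → F →L[ℝ] F}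

lemma spinOrbit_add {f g : EuclideanSpace ℝ (Fin 3) → F} (hf : ContDiff ℝ ∞ f)
    (hg : ContDiff ℝ ∞ g) : spinOrbit σ (f + g) = spinOrbit σ f + spinOrbit σ g := by
  ext x
  simp only [spinOrbit, diracOp_add hf hg, Pi.add_apply, map_add,
    fderiv_add (hf.differentiable (by simp) x) (hg.differentiable (by simp) x),
    add_apply]
  abel

lemma spinOrbit_smul (c : ℝ) {f : EuclideanSpace ℝ (Fin 3) → F} (hf : ContDiff ℝ ∞ f) :
    spinOrbit σ (c • f) = c • spinOrbit σ f := by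
  ext x
  simp [spinOrbit, diracOp_smul c hf, fderiv_const_smul (hf.differentiable (by simp) x), smul_sub]

/-- The `L²` class of the restriction of a continuous function to the unit sphere. -/
def sphereLp [FiniteDimensional ℝ F] :
    C(sphere (0 : EuclideanSpace ℝ (Fin 3)) 1, F) →L[ℝ]
      Lp F 2 (volume : Measure (EuclideanSpace ℝ (Fin 3))).toSphere :=
  ContinuousMap.toLp 2 _ ℝ

variable [FiniteDimensional ℝ F]

lemma inner_sphereLp (u v : C(sphere (0 : EuclideanSpace ℝ (Fin 3)) 1, F)) :
    inner ℝ (sphereLp u) (sphereLp v) =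
      ∫ y, inner ℝ (u y) (v y) ∂(volume : Measure (EuclideanSpace ℝ (Fin 3))).toSphere := by
  rw [L2.inner_def]
  refine integral_congr_ae ?_
  filter_upwards [ContinuousMap.coeFn_toLp (p := 2) (𝕜 := ℝ)
    (volume : Measure (EuclideanSpace ℝ (Fin 3))).toSphere u,
    ContinuousMap.coeFn_toLp (p := 2) (𝕜 := ℝ)
    (volume : Measure (EuclideanSpace ℝ (Fin 3))).toSphere v] with y hu hv
  unfold sphereLp
  rw [hu, hv]

lemma norm_sphereLp_sq (u : C(sphere (0 : EuclideanSpace ℝ (Fin 3)) 1, F)) :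
    ‖sphereLp u‖ ^ 2 =
      ∫ y, ‖u y‖ ^ 2 ∂(volume : Measure (EuclideanSpace ℝ (Fin 3))).toSphere := by
  rw [← real_inner_self_eq_norm_sq, inner_sphereLp]
  simp_rw [real_inner_self_eq_norm_sq]

/-- The `L²` classes of the restrictions to the sphere of the smooth spin-orbit eigenfunctions with
eigenvalue `k`. -/
def eigenLp (σ : Fin 3 → F →L[ℝ] F) (k : ℝ) :
    Submodule ℝ (Lp F 2 (volume : Measure (EuclideanSpace ℝ (Fin 3))).toSphere) where
  carrier := {v | ∃ f : C(EuclideanSpace ℝ (Fin 3), F), IsSpinOrbitEigen σ k f ∧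
    v = sphereLp (f.restrict _)}
  add_mem' := by
    rintro _ _ ⟨f, hf, rfl⟩ ⟨g, hg, rfl⟩
    refine ⟨f + g, ⟨hf.1.add hg.1, fun x => ?_⟩, ?_⟩
    · rw [ContinuousMap.coe_add, spinOrbit_add hf.1 hg.1]
      simp [hf.2, hg.2]
    · rw [← map_add]; rfl
  zero_mem' := ⟨0, ⟨contDiff_const, fun x => by simp [spinOrbit, diracOp]⟩,
    (map_zero (sphereLp (F := F))).symm⟩
  smul_mem' := by
    rintro c _ ⟨f, hf, rfl⟩
    refine ⟨c • f, ⟨contDiff_const.smul hf.1, fun x => ?_⟩, ?_⟩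
    · rw [ContinuousMap.coe_smul, spinOrbit_smul c hf.1]
      simp [hf.2, smul_comm c k]
    · rw [← map_smul]; rfl

lemma inner_eq_zero_of_mem_eigenLp (hσ : IsCliffordTriple σ) {k l : ℝ} (hkl : k ≠ l)
    {u v : Lp F 2 (volume : Measure (EuclideanSpace ℝ (Fin 3))).toSphere}
    (hu : u ∈ eigenLp σ k) (hv : v ∈ eigenLp σ l) : inner ℝ u v = 0 := by
  obtain ⟨f, hf, rfl⟩ := hu
  obtain ⟨g, hg, rfl⟩ := hv
  have h := integral_inner_spinOrbit hσ hf.1 hg.1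
  simp_rw [hf.2, hg.2, inner_smul_left, inner_smul_right, integral_const_mul] at h
  rw [inner_sphereLp]
  have h' : (k - l) * ∫ y : sphere (0 : EuclideanSpace ℝ (Fin 3)) 1, inner ℝ (f y) (g y)
      ∂(volume : Measure (EuclideanSpace ℝ (Fin 3))).toSphere = 0 := by
    rw [sub_mul, sub_eq_zero]; simpa using h
  exact (mul_eq_zero.1 h').resolve_left (sub_ne_zero.2 hkl)

lemma exists_orthonormal_eigenLp (hσ : IsCliffordTriple σ)
    (t : Finset (Lp F 2 (volume : Measure (EuclideanSpace ℝ (Fin 3))).toSphere))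
    (ht : ∀ v ∈ t, ∃ k, 0 ≤ k * (k + 2) ∧ v ∈ eigenLp σ k) :
    ∃ (ι : Type) (_ : Fintype ι)
      (e : ι → Lp F 2 (volume : Measure (EuclideanSpace ℝ (Fin 3))).toSphere),
      Orthonormal ℝ e ∧ (∀ i, ∃ k, 0 ≤ k * (k + 2) ∧ e i ∈ eigenLp σ k) ∧
      ∀ v ∈ t, v ∈ Submodule.span ℝ (Set.range e) := by
  classical
  induction t using Finset.induction_on with
  | empty => exact ⟨Empty, inferInstance, Empty.elim, by simp [Orthonormal, Pairwise], by simp,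
      by simp⟩
  | insert v t _ ih =>
    obtain ⟨ι, hι, e, he, hek, hspan⟩ := ih fun u hu => ht u (Finset.mem_insert_of_mem hu)
    obtain ⟨k, hk, hv⟩ := ht v (Finset.mem_insert_self v t)
    set p := ∑ i, inner ℝ (e i) v • e i with hp
    have hp_mem : p ∈ Submodule.span ℝ (Set.range e) :=
      Submodule.sum_mem _ fun i _ => Submodule.smul_mem _ _ (Submodule.subset_span ⟨i, rfl⟩)
    have hpk : p ∈ eigenLp σ k := by
      refine Submodule.sum_mem _ fun i _ => ?_
      obtain ⟨l, -, hl⟩ := hek i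
      by_cases hlk : l = k
      · exact Submodule.smul_mem _ _ (hlk ▸ hl)
      · rw [inner_eq_zero_of_mem_eigenLp hσ hlk hl hv, zero_smul]
        exact Submodule.zero_mem _
    have horth : ∀ i, inner ℝ (e i) (v - p) = 0 := fun i => by
      rw [inner_sub_right, hp, he.inner_right_fintype, sub_self]
    by_cases hw : v - p = 0
    · refine ⟨ι, hι, e, he, hek, fun u hu => ?_⟩
      rcases Finset.mem_insert.1 hu with rfl | hu
      · rw [sub_eq_zero.1 hw]; exact hp_mem
      · exact hspan u hu
    · have hw' : ‖v - p‖ ≠ 0 := norm_ne_zero_iff.2 hw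
      let e' : Option ι → Lp F 2 (volume : Measure (EuclideanSpace ℝ (Fin 3))).toSphere :=
        fun o => o.elim (‖v - p‖⁻¹ • (v - p)) e
      have hle : Submodule.span ℝ (Set.range e) ≤ Submodule.span ℝ (Set.range e') :=
        Submodule.span_mono (by rintro _ ⟨i, rfl⟩; exact ⟨some i, rfl⟩)
      refine ⟨Option ι, inferInstance, e', ⟨?_, ?_⟩, ?_, fun u hu => ?_⟩
      · rintro (_ | i)
        · simp [e', norm_smul, hw']
        · exact he.1 i
      · rintro (_ | i) (_ | j) hij
        · exact absurd rfl hij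
        · simp only [e', Option.elim, inner_smul_left]
          rw [real_inner_comm, horth, mul_zero]
        · simp only [e', Option.elim, inner_smul_right]
          rw [horth, mul_zero]
        · exact he.2 fun h => hij (congrArg some h)
      · rintro (_ | i)
        · exact ⟨k, hk, Submodule.smul_mem _ _ (Submodule.sub_mem _ hv hpk)⟩
        · exact hek i
      · rcases Finset.mem_insert.1 hu with rfl | hu
        · have h1 : u = ‖u - p‖ • e' none + p := by
            simp [e', smul_smul, hw']
          rw [h1]
          exact Submodule.add_mem _ (Submodule.smul_mem _ _ (Submodule.subset_span ⟨none, rfl⟩))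
            (hle hp_mem)
        · exact hle (hspan u hu)

lemma Orthonormal.norm_sq_sub_sum_inner_sq_le {H : Type*} [NormedAddCommGroup H]
    [InnerProductSpace ℝ H] {ι : Type*} [Fintype ι] {e : ι → H} (he : Orthonormal ℝ e) {p : H}
    (hp : p ∈ Submodule.span ℝ (Set.range e)) (v : H) :
    ‖v‖ ^ 2 - ∑ i, inner ℝ (e i) v ^ 2 ≤ ‖v - p‖ ^ 2 := by
  obtain ⟨c, rfl⟩ := (Submodule.mem_span_range_iff_exists_fun ℝ).1 hp
  have h1 : inner ℝ v (∑ i, c i • e i) = ∑ i, c i * inner ℝ (e i) v := by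
    simp [inner_sum, inner_smul_right, real_inner_comm]
  have h2 : ‖∑ i, c i • e i‖ ^ 2 = ∑ i, c i ^ 2 := by
    rw [← real_inner_self_eq_norm_sq, he.inner_sum]
    simp [sq]
  rw [norm_sub_sq_real, h1, h2]
  have h3 : 0 ≤ ∑ i, (c i - inner ℝ (e i) v) ^ 2 := Finset.sum_nonneg fun i _ => sq_nonneg _
  have h4 : ∑ i, (c i - inner ℝ (e i) v) ^ 2 = ∑ i, c i ^ 2 - 2 * ∑ i, c i * inner ℝ (e i) v
      + ∑ i, inner ℝ (e i) v ^ 2 := by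
    rw [Finset.mul_sum, ← Finset.sum_sub_distrib, ← Finset.sum_add_distrib]
    exact Finset.sum_congr rfl fun i _ => by ring
  linarith

end Eigenbasis

section RadialInequality

open Metric

variable {F : Type*} [NormedAddCommGroup F] [InnerProductSpace ℝ F]
  {σ : Fin 3 → F →L[ℝ] F} {φ : EuclideanSpace ℝ (Fin 3) → F}

lemma spinOrbit_comp_smul (hφ : ContDiff ℝ ∞ φ) (r : ℝ) (y : EuclideanSpace ℝ (Fin 3)) :
    spinOrbit σ (fun x => φ (r • x)) y =
      r • fderiv ℝ φ (r • y) y - r • cliffMul σ y (diracOp σ φ (r • y)) := by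
  have h : ∀ v, fderiv ℝ (fun x => φ (r • x)) y v = r • fderiv ℝ φ (r • y) v := fun v => by
    have h1 : HasFDerivAt (fun x : EuclideanSpace ℝ (Fin 3) => r • x)
      (r • ContinuousLinearMap.id ℝ _) y := (hasFDerivAt_id y).const_smul r
    have h2 := ((hφ.differentiable (by simp) (r • y)).hasFDerivAt).comp y h1
    have h3 : fderiv ℝ (fun x => φ (r • x)) y = _ := h2.fderiv
    rw [h3]
    simp
  simp only [spinOrbit, diracOp, h, map_smul, ← Finset.smul_sum]

lemma continuous_cliffMul_diracOp (hφ : ContDiff ℝ ∞ φ) (r : ℝ) :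
    Continuous fun y : sphere (0 : EuclideanSpace ℝ (Fin 3)) 1 =>
      cliffMul σ y.1 (diracOp σ φ (r • y.1)) := by
  have h1 : Continuous (cliffMul σ) := contDiff_cliffMul.continuous
  have h2 : Continuous (diracOp σ φ) := (contDiff_diracOp hφ).continuous
  fun_prop

/-- The restriction of a continuous function to the sphere of radius `r`, pulled back to the unit
sphere. -/
def dilation {f : EuclideanSpace ℝ (Fin 3) → F} (hf : Continuous f) (r : ℝ) :
    C(sphere (0 : EuclideanSpace ℝ (Fin 3)) 1, F) :=
  ⟨fun y => f (r • y.1), by fun_prop⟩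

variable [FiniteDimensional ℝ F]

lemma exists_orthonormal_eigen_near (hσ : IsCliffordTriple σ)
    {f : EuclideanSpace ℝ (Fin 3) → F} (hf : Continuous f) (R : ℝ) {ε : ℝ} (hε : 0 < ε) :
    ∃ (ι : Type) (_ : Fintype ι) (k : ι → ℝ) (Y : ι → C(EuclideanSpace ℝ (Fin 3), F)),
      (∀ i, 0 ≤ k i * (k i + 2)) ∧ (∀ i, IsSpinOrbitEigen σ (k i) (Y i)) ∧
      Orthonormal ℝ (fun i => sphereLp ((Y i).restrict (sphere 0 1))) ∧
      ∀ r, |r| ≤ R → ‖sphereLp (dilation hf r)‖ ^ 2 -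
          ∑ i, inner ℝ (sphereLp ((Y i).restrict (sphere 0 1))) (sphereLp (dilation hf r)) ^ 2 ≤
        (volume : Measure (EuclideanSpace ℝ (Fin 3))).toSphere.real Set.univ * ε ^ 2 := by
  classical
  obtain ⟨p, hp, hpf⟩ := exists_mem_homogeneousSpan_near hf R hε
  obtain ⟨t, ht, htp⟩ := exists_finset_eigen_of_mem_homogeneousSpan hσ hp
  choose! k f' hk hf' htf using ht
  let L : (sphere (0 : EuclideanSpace ℝ (Fin 3)) 1 → F) →
      C(sphere (0 : EuclideanSpace ℝ (Fin 3)) 1, F) := fun u =>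
    if h : Continuous u then ⟨u, h⟩ else 0
  have hL : ∀ u ∈ t, ⇑(L u) = u := fun u hu => by
    have h : Continuous u := by
      rw [htf u hu]
      exact (hf' u hu).1.continuous.comp continuous_subtype_val
    simp [L, h]
  obtain ⟨ι, hι, e, he, hek, hspan⟩ := exists_orthonormal_eigenLp hσ
    (t.image fun u => sphereLp (L u)) (by
      intro v hv
      obtain ⟨u, hu, rfl⟩ := Finset.mem_image.1 hv
      refine ⟨k u, hk u hu, ⟨f' u, (hf' u hu).1.continuous⟩, hf' u hu, ?_⟩
      congr 1
      ext y
      rw [hL u hu]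
      exact congrFun (htf u hu) y)
  choose l hl Y hY hYe using hek
  have hYe' : (fun i => sphereLp ((Y i).restrict (sphere 0 1))) = e :=
    funext fun i => (hYe i).symm
  refine ⟨ι, hι, l, Y, hl, hY, by rwa [hYe'], fun r hr => ?_⟩
  have key : ∀ w ∈ Submodule.span ℝ (t : Set (sphere (0 : EuclideanSpace ℝ (Fin 3)) 1 → F)),
      ∃ q : C(sphere (0 : EuclideanSpace ℝ (Fin 3)) 1, F), ⇑q = w ∧
        sphereLp q ∈ Submodule.span ℝ (Set.range e) := by
    intro w hw
    induction hw using Submodule.span_induction with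
    | mem u hu => exact ⟨L u, hL u hu, hspan _ (Finset.mem_image_of_mem _ hu)⟩
    | zero => exact ⟨0, rfl, by simp⟩
    | add u v _ _ hu hv =>
      obtain ⟨q, rfl, hq⟩ := hu
      obtain ⟨q', rfl, hq'⟩ := hv
      exact ⟨q + q', rfl, by rw [map_add]; exact Submodule.add_mem _ hq hq'⟩
    | smul c u _ hu =>
      obtain ⟨q, rfl, hq⟩ := hu
      exact ⟨c • q, rfl, by rw [map_smul]; exact Submodule.smul_mem _ _ hq⟩
  obtain ⟨q, hq, hqe⟩ := key _ (htp r)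
  simp_rw [← hYe]
  refine (he.norm_sq_sub_sum_inner_sq_le hqe _).trans ?_
  rw [← map_sub, norm_sphereLp_sq, ← smul_eq_mul, ← integral_const]
  refine integral_mono (integrable_sphere_of_continuous (by fun_prop)) (integrable_const _)
    fun y => ?_
  have h := hpf (r • y.1) (by simpa [norm_smul] using hr)
  have h2 : q y = p (r • y.1) := congrFun hq y
  simp only [ContinuousMap.sub_apply, h2]
  exact pow_le_pow_left₀ (norm_nonneg _) h 2

lemma hasDerivAt_inner_dilation (hφ : ContDiff ℝ ∞ φ) (Y : C(EuclideanSpace ℝ (Fin 3), F)) (r : ℝ) :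
    HasDerivAt (fun r => inner ℝ (sphereLp (Y.restrict (sphere 0 1)))
        (sphereLp (dilation hφ.continuous r)))
      (∫ y : sphere (0 : EuclideanSpace ℝ (Fin 3)) 1, inner ℝ (Y y) (fderiv ℝ φ (r • y.1) y.1)
        ∂(volume : Measure (EuclideanSpace ℝ (Fin 3))).toSphere) r := by
  simp_rw [inner_sphereLp]
  have hφ' : Continuous (fderiv ℝ φ) := hφ.continuous_fderiv (by simp)
  have hφc := hφ.continuous
  refine hasDerivAt_integral_of_continuous
    (G := fun r (y : sphere (0 : EuclideanSpace ℝ (Fin 3)) 1) => inner ℝ (Y y) (φ (r • y.1)))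
    (G' := fun r (y : sphere (0 : EuclideanSpace ℝ (Fin 3)) 1) =>
      inner ℝ (Y y) (fderiv ℝ φ (r • y.1) y.1)) (fun t => ?_) ?_ (fun t y => ?_) r
  · fun_prop
  · have h1 : Continuous fun z : ℝ × sphere (0 : EuclideanSpace ℝ (Fin 3)) 1 =>
      fderiv ℝ φ (z.1 • z.2.1) z.2.1 := (hφ'.comp (by fun_prop)).clm_apply (by fun_prop)
    have h2 : Continuous fun z : ℝ × sphere (0 : EuclideanSpace ℝ (Fin 3)) 1 => Y z.2.1 := by
      fun_prop
    exact h2.inner h1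
  · have h1 : HasDerivAt (fun s : ℝ => φ (s • y.1)) (fderiv ℝ φ (t • y.1) y.1) t := by
      have h2 : HasDerivAt (fun s : ℝ => s • y.1) y.1 t := by
        simpa using (hasDerivAt_id t).smul_const y.1
      exact ((hφ.differentiable (by simp) (t • y.1)).hasFDerivAt).comp_hasDerivAt t h2
    simpa using (hasDerivAt_const t (Y y)).inner ℝ h1

lemma integral_inner_cliffMul_diracOp (hσ : IsCliffordTriple σ) (hφ : ContDiff ℝ ∞ φ) {k : ℝ}
    {Y : C(EuclideanSpace ℝ (Fin 3), F)} (hY : IsSpinOrbitEigen σ k Y) (r : ℝ) :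
    r * inner ℝ (sphereLp (Y.restrict (sphere 0 1)))
        (sphereLp ⟨_, continuous_cliffMul_diracOp (σ := σ) hφ r⟩) =
      r * (∫ y : sphere (0 : EuclideanSpace ℝ (Fin 3)) 1, inner ℝ (Y y) (fderiv ℝ φ (r • y.1) y.1)
        ∂(volume : Measure (EuclideanSpace ℝ (Fin 3))).toSphere) -
      k * inner ℝ (sphereLp (Y.restrict (sphere 0 1))) (sphereLp (dilation hφ.continuous r)) := by
  have hφ' : Continuous (fderiv ℝ φ) := hφ.continuous_fderiv (by simp)
  have hc := continuous_cliffMul_diracOp (σ := σ) hφ r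
  have h := integral_inner_spinOrbit hσ hY.1
    (by fun_prop : ContDiff ℝ ∞ fun x => φ (r • x))
  simp_rw [hY.2, spinOrbit_comp_smul hφ, inner_sub_right, inner_smul_right, inner_smul_left] at h
  rw [integral_sub, integral_const_mul, integral_const_mul, integral_const_mul] at h
  · simp only [inner_sphereLp, ContinuousMap.restrict_apply, ContinuousMap.coe_mk, dilation]
    simp only [conj_trivial] at h
    linarith
  · refine integrable_sphere_of_continuous ?_
    have : Continuous fun y : sphere (0 : EuclideanSpace ℝ (Fin 3)) 1 => Y y.1 := by fun_prop
    have h2 : Continuous fun y : sphere (0 : EuclideanSpace ℝ (Fin 3)) 1 =>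
      fderiv ℝ φ (r • y.1) y.1 := (hφ'.comp (by fun_prop)).clm_apply (by fun_prop)
    exact continuous_const.mul (this.inner h2)
  · refine integrable_sphere_of_continuous ?_
    have : Continuous fun y : sphere (0 : EuclideanSpace ℝ (Fin 3)) 1 => Y y.1 := by fun_prop
    exact continuous_const.mul (this.inner hc)

end RadialInequality

section RadialIntegral

open Metric

lemma channel_inequality {r k s f d g : ℝ} (hr : 0 < r) (hs : s ^ 2 = 1) (hsk : 1 ≤ s * (k + 1))
    (h : r * g = r * d - k * f) :
    -(s * (2 * r * f ^ 2 + r ^ 2 * (2 * f * d))) ≤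
      r ^ 2 * (r / (1 + r)) * g ^ 2 + (r ^ 2 - r) * f ^ 2 := by
  have hd : r ^ 2 * (2 * f * d) = 2 * r * f * (r * g + k * f) := by rw [h]; ring
  have h1 : 0 ≤ r / (1 + r) * (r * g + s * (1 + r) * f) ^ 2 := by positivity
  have h2 : r / (1 + r) * (r * g + s * (1 + r) * f) ^ 2 =
      r ^ 2 * (r / (1 + r)) * g ^ 2 + 2 * s * r ^ 2 * f * g + s ^ 2 * (r * (1 + r) * f ^ 2) := by
    field_simp
    ring
  have h3 : 0 ≤ (s * (k + 1) - 1) * (r * f ^ 2) :=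
    mul_nonneg (by linarith) (by positivity)
  rw [h2, hs] at h1
  rw [hd]
  linarith

lemma continuous_integral_sphere {G : EuclideanSpace ℝ (Fin 3) → ℝ} (hG : Continuous G) :
    Continuous fun r : ℝ => ∫ y : sphere (0 : EuclideanSpace ℝ (Fin 3)) 1, G (r • y.1)
      ∂(volume : Measure (EuclideanSpace ℝ (Fin 3))).toSphere := by
  have h := continuous_parametric_integral_of_continuous
    (μ := (volume : Measure (EuclideanSpace ℝ (Fin 3))).toSphere)
    (f := fun (r : ℝ) (y : sphere (0 : EuclideanSpace ℝ (Fin 3)) 1) => G (r • y.1))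
    (by unfold Function.uncurry; fun_prop) isCompact_univ
  simpa using h

variable {F : Type*} [NormedAddCommGroup F] [InnerProductSpace ℝ F] [FiniteDimensional ℝ F]
  {σ : Fin 3 → F →L[ℝ] F} {φ : EuclideanSpace ℝ (Fin 3) → F}

lemma intervalIntegral_radial_add_nonneg (hσ : IsCliffordTriple σ) (hφ : ContDiff ℝ ∞ φ) {R : ℝ}
    (hR : 0 < R) (hφR : ∀ x, ‖x‖ = R → φ x = 0) {ε : ℝ} (hε : 0 < ε) :
    0 ≤ ∫ r in (0 : ℝ)..R, (r ^ 2 * (r / (1 + r)) *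
        (∫ y : sphere (0 : EuclideanSpace ℝ (Fin 3)) 1, ‖diracOp σ φ (r • y.1)‖ ^ 2
          ∂(volume : Measure (EuclideanSpace ℝ (Fin 3))).toSphere) +
        (r ^ 2 - r) * (∫ y : sphere (0 : EuclideanSpace ℝ (Fin 3)) 1, ‖φ (r • y.1)‖ ^ 2
          ∂(volume : Measure (EuclideanSpace ℝ (Fin 3))).toSphere) +
        r * ((volume : Measure (EuclideanSpace ℝ (Fin 3))).toSphere.real Set.univ * ε ^ 2)) := by
  obtain ⟨ι, hι, k, Y, hk, hY, hort, hnear⟩ :=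
    exists_orthonormal_eigen_near hσ hφ.continuous R hε
  set Φ : ℝ → ℝ := fun r => ∫ y : sphere (0 : EuclideanSpace ℝ (Fin 3)) 1, ‖φ (r • y.1)‖ ^ 2
    ∂(volume : Measure (EuclideanSpace ℝ (Fin 3))).toSphere with hΦ
  set P : ℝ → ℝ := fun r => ∫ y : sphere (0 : EuclideanSpace ℝ (Fin 3)) 1,
    ‖diracOp σ φ (r • y.1)‖ ^ 2 ∂(volume : Measure (EuclideanSpace ℝ (Fin 3))).toSphere with hP
  set M := (volume : Measure (EuclideanSpace ℝ (Fin 3))).toSphere.real Set.univ with hM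
  let f : ι → ℝ → ℝ := fun i r => inner ℝ (sphereLp ((Y i).restrict (sphere 0 1)))
    (sphereLp (dilation hφ.continuous r))
  let d : ι → ℝ → ℝ := fun i r => ∫ y : sphere (0 : EuclideanSpace ℝ (Fin 3)) 1,
    inner ℝ (Y i y) (fderiv ℝ φ (r • y.1) y.1)
      ∂(volume : Measure (EuclideanSpace ℝ (Fin 3))).toSphere
  let g : ι → ℝ → ℝ := fun i r => inner ℝ (sphereLp ((Y i).restrict (sphere 0 1)))
    (sphereLp ⟨_, continuous_cliffMul_diracOp (σ := σ) hφ r⟩)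
  let s : ι → ℝ := fun i => if 0 ≤ k i then 1 else -1
  have hs : ∀ i, s i ^ 2 = 1 := fun i => by by_cases h : 0 ≤ k i <;> simp [s, h]
  have hsk : ∀ i, 1 ≤ s i * (k i + 1) := fun i => by
    by_cases h : 0 ≤ k i
    · simp [s, h]
    · have := hk i
      simp only [s, h, if_false]
      push Not at h
      nlinarith
  have hfd : ∀ i r, HasDerivAt (f i) (d i r) r := fun i r => hasDerivAt_inner_dilation hφ (Y i) r
  have hg : ∀ i r, r * g i r = r * d i r - k i * f i r := fun i r =>
    integral_inner_cliffMul_diracOp hσ hφ (hY i) r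
  have hgP : ∀ r, ∑ i, g i r ^ 2 ≤ P r := fun r => by
    have h := hort.sum_inner_products_le (s := Finset.univ)
      (x := sphereLp ⟨_, continuous_cliffMul_diracOp (σ := σ) hφ r⟩)
    rw [norm_sphereLp_sq] at h
    simp only [Real.norm_eq_abs, sq_abs, ContinuousMap.coe_mk] at h
    refine h.trans_eq (integral_congr_ae (.of_forall fun y => ?_))
    simp only
    rw [norm_cliffMul hσ (by simp)]
  have hfΦ : ∀ r, ∑ i, f i r ^ 2 ≤ Φ r := fun r => by
    have h := hort.sum_inner_products_le (s := Finset.univ)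
      (x := sphereLp (dilation hφ.continuous r))
    rw [norm_sphereLp_sq] at h
    simp only [Real.norm_eq_abs, sq_abs] at h
    exact h
  have hΦf : ∀ r, |r| ≤ R → Φ r - ∑ i, f i r ^ 2 ≤ M * ε ^ 2 := fun r hr => by
    have h := hnear r hr
    rwa [norm_sphereLp_sq] at h
  have hΦc : Continuous Φ :=
    continuous_integral_sphere (G := fun x => ‖φ x‖ ^ 2) (by have := hφ.continuous; fun_prop)
  have hPc : Continuous P :=
    continuous_integral_sphere (G := fun x => ‖diracOp σ φ x‖ ^ 2)
      (by have := (contDiff_diracOp (σ := σ) hφ).continuous; fun_prop)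
  have hder : ∀ r, HasDerivAt (fun r => -∑ i, s i * (r ^ 2 * f i r ^ 2))
      (-∑ i, s i * (2 * r * f i r ^ 2 + r ^ 2 * (2 * f i r * d i r))) r := fun r => by
    refine (HasDerivAt.fun_sum fun i _ => ?_).neg
    refine HasDerivAt.const_mul _ ?_
    simpa using (hasDerivAt_pow 2 r).fun_mul ((hfd i r).fun_pow 2)
  have hfR : ∀ i, f i R = 0 := fun i => by
    have : dilation hφ.continuous R = 0 := by
      ext1 y
      exact hφR _ (by simp [norm_smul, abs_of_pos hR])
    simp [f, this]
  have key := intervalIntegral.sub_le_integral_of_hasDeriv_right_of_le hR.le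
    (g := fun r => -∑ i, s i * (r ^ 2 * f i r ^ 2))
    (φ := fun r => r ^ 2 * (r / (1 + r)) * P r + (r ^ 2 - r) * Φ r + r * (M * ε ^ 2))
    (fun r _ => (hder r).continuousAt.continuousWithinAt)
    (fun r _ => (hder r).hasDerivWithinAt) ?_ ?_
  · simpa [hfR] using key
  · refine ContinuousOn.integrableOn_Icc ?_
    have : ContinuousOn (fun r : ℝ => r / (1 + r)) (Set.Icc 0 R) :=
      continuousOn_id.div (by fun_prop) fun r hr => by
        have := hr.1
        positivity
    fun_prop
  · intro r hr
    have hr0 := hr.1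
    have hw : 0 ≤ r ^ 2 * (r / (1 + r)) := by positivity
    have h1 : -∑ i, s i * (2 * r * f i r ^ 2 + r ^ 2 * (2 * f i r * d i r)) ≤
        ∑ i, (r ^ 2 * (r / (1 + r)) * g i r ^ 2 + (r ^ 2 - r) * f i r ^ 2) := by
      rw [← Finset.sum_neg_distrib]
      exact Finset.sum_le_sum fun i _ => channel_inequality hr0 (hs i) (hsk i) (hg i r)
    rw [Finset.sum_add_distrib, ← Finset.mul_sum, ← Finset.mul_sum] at h1
    have h2 := mul_le_mul_of_nonneg_left (hgP r) hw
    have h3 := mul_le_mul_of_nonneg_left (hfΦ r) (sq_nonneg r)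
    have h4 := mul_le_mul_of_nonneg_left (hΦf r (by rw [abs_of_pos hr0]; exact hr.2.le)) hr0.le
    linarith

lemma intervalIntegral_radial_nonneg (hσ : IsCliffordTriple σ) (hφ : ContDiff ℝ ∞ φ) {R : ℝ}
    (hR : 0 < R) (hφR : ∀ x, ‖x‖ = R → φ x = 0) :
    0 ≤ ∫ r in (0 : ℝ)..R, (r ^ 2 * (r / (1 + r)) *
        (∫ y : sphere (0 : EuclideanSpace ℝ (Fin 3)) 1, ‖diracOp σ φ (r • y.1)‖ ^ 2
          ∂(volume : Measure (EuclideanSpace ℝ (Fin 3))).toSphere) +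
        (r ^ 2 - r) * (∫ y : sphere (0 : EuclideanSpace ℝ (Fin 3)) 1, ‖φ (r • y.1)‖ ^ 2
          ∂(volume : Measure (EuclideanSpace ℝ (Fin 3))).toSphere)) := by
  have hΦc := continuous_integral_sphere (G := fun x => ‖φ x‖ ^ 2)
    (by have := hφ.continuous; fun_prop)
  have hPc := continuous_integral_sphere (G := fun x => ‖diracOp σ φ x‖ ^ 2)
      (by have := (contDiff_diracOp (σ := σ) hφ).continuous; fun_prop)
  set M := (volume : Measure (EuclideanSpace ℝ (Fin 3))).toSphere.real Set.univ with hM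
  have hw : ContinuousOn (fun r : ℝ => r / (1 + r)) (Set.Icc 0 R) :=
    continuousOn_id.div (by fun_prop) fun r hr => by
      have := hr.1
      positivity
  have hlim : ∀ I : ℝ, Filter.Tendsto (fun ε : ℝ => I + R ^ 2 / 2 * (M * ε ^ 2))
      (nhdsWithin 0 (Set.Ioi 0)) (nhds I) := fun I =>
    tendsto_nhdsWithin_of_tendsto_nhds (Continuous.tendsto' (by fun_prop) _ _ (by simp))
  refine ge_of_tendsto (hlim _) ?_
  filter_upwards [self_mem_nhdsWithin] with ε hε
  have h := intervalIntegral_radial_add_nonneg hσ hφ hR hφR hε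
  rw [intervalIntegral.integral_add, intervalIntegral.integral_mul_const, integral_id] at h
  · simpa only [zero_pow two_ne_zero, ne_eq, OfNat.ofNat_ne_zero, not_false_eq_true, sub_zero] using h
  · exact ((((continuousOn_id.pow 2).mul hw).mul hPc.continuousOn).add
      (((continuousOn_id.pow 2).sub continuousOn_id).mul hΦc.continuousOn)).intervalIntegrable_of_Icc
        hR.le
  · exact (continuous_id.mul continuous_const).intervalIntegrable _ _

end RadialIntegral

section Polar

open Metric

lemma integral_eq_integral_Ioi_sphere {G : EuclideanSpace ℝ (Fin 3) → ℝ} (hG : Integrable G) :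
    ∫ x, G x = ∫ r in Set.Ioi (0 : ℝ), r ^ 2 *
      ∫ y : sphere (0 : EuclideanSpace ℝ (Fin 3)) 1, G (r • y.1)
        ∂(volume : Measure (EuclideanSpace ℝ (Fin 3))).toSphere := by
  have hmp := (volume : Measure (EuclideanSpace ℝ (Fin 3))).measurePreserving_homeomorphUnitSphereProd
  have hemb := (homeomorphUnitSphereProd (EuclideanSpace ℝ (Fin 3))).measurableEmbedding
  have hd : Module.finrank ℝ (EuclideanSpace ℝ (Fin 3)) - 1 = 2 := by simp
  rw [hd] at hmp
  let H : sphere (0 : EuclideanSpace ℝ (Fin 3)) 1 × Set.Ioi (0 : ℝ) → ℝ :=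
    fun z => G (z.2.1 • z.1.1)
  have hH : ∀ x : ({0}ᶜ : Set (EuclideanSpace ℝ (Fin 3))),
      H (homeomorphUnitSphereProd _ x) = G x := fun x => by
    have : x.1 ≠ 0 := x.2
    simp [H, this]
  have hI : Integrable H ((volume : Measure (EuclideanSpace ℝ (Fin 3))).toSphere.prod
      (.volumeIoiPow 2)) := by
    rw [← hmp.integrable_comp_emb hemb]
    have h1 : H ∘ homeomorphUnitSphereProd (EuclideanSpace ℝ (Fin 3)) =
      G ∘ (↑) := funext hH
    rw [h1, ← integrableOn_iff_comap_subtypeVal (measurableSet_singleton _).compl]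
    exact hG.integrableOn
  calc
    ∫ x, G x = ∫ x : ({0}ᶜ : Set (EuclideanSpace ℝ (Fin 3))), G x
        ∂(volume : Measure (EuclideanSpace ℝ (Fin 3))).comap (↑) := by
      rw [integral_subtype_comap (measurableSet_singleton _).compl G, restrict_compl_singleton]
    _ = ∫ z, H z ∂(volume : Measure (EuclideanSpace ℝ (Fin 3))).toSphere.prod
        (.volumeIoiPow 2) := by
      rw [← hmp.integral_comp hemb]
      exact integral_congr_ae (.of_forall fun x => (hH x).symm)
    _ = ∫ r : Set.Ioi (0 : ℝ), (∫ y : sphere (0 : EuclideanSpace ℝ (Fin 3)) 1, G (r.1 • y.1)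
        ∂(volume : Measure (EuclideanSpace ℝ (Fin 3))).toSphere) ∂.volumeIoiPow 2 :=
      integral_prod_symm _ hI
    _ = _ := by
      simp only [Measure.volumeIoiPow, ENNReal.ofReal]
      rw [integral_withDensity_eq_integral_smul
        ((measurable_subtype_coe.pow_const _).real_toNNReal),
        integral_subtype_comap measurableSet_Ioi fun a : ℝ => Real.toNNReal (a ^ 2) •
          ∫ y : sphere (0 : EuclideanSpace ℝ (Fin 3)) 1, G (a • y.1)
            ∂(volume : Measure (EuclideanSpace ℝ (Fin 3))).toSphere]
      refine setIntegral_congr_fun measurableSet_Ioi fun r hr => ?_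
      rw [NNReal.smul_def, Real.coe_toNNReal _ (sq_nonneg r), smul_eq_mul]

lemma integral_eq_intervalIntegral_sphere {G : EuclideanSpace ℝ (Fin 3) → ℝ} (hG : Integrable G)
    {R : ℝ} (hR : 0 ≤ R) (hGR : ∀ x, R < ‖x‖ → G x = 0) :
    ∫ x, G x = ∫ r in (0 : ℝ)..R, r ^ 2 *
      ∫ y : sphere (0 : EuclideanSpace ℝ (Fin 3)) 1, G (r • y.1)
        ∂(volume : Measure (EuclideanSpace ℝ (Fin 3))).toSphere := by
  rw [integral_eq_integral_Ioi_sphere hG, intervalIntegral.integral_of_le hR]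
  refine setIntegral_eq_of_subset_of_forall_sdiff_eq_zero measurableSet_Ioi
    Set.Ioc_subset_Ioi_self fun r hr => ?_
  have hr0 : 0 < r := hr.1
  have hrR : R < r := by
    by_contra h
    exact hr.2 ⟨hr0, not_lt.1 h⟩
  have h : ∀ y : sphere (0 : EuclideanSpace ℝ (Fin 3)) 1, G (r • y.1) = 0 := fun y =>
    hGR _ (by simpa [norm_smul, abs_of_pos hr0] using hrR)
  simp [h]

end Polar

section HardyDirac

open Metric

variable {F : Type*} [NormedAddCommGroup F] [InnerProductSpace ℝ F]
  {σ : Fin 3 → F →L[ℝ] F} {φ : EuclideanSpace ℝ (Fin 3) → F}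

lemma integrable_diracOp_div_add (hφ : ContDiff ℝ ∞ φ) (hφc : HasCompactSupport φ) :
    Integrable fun x => ‖diracOp σ φ x‖ ^ 2 / (1 + 1 / ‖x‖) + ‖φ x‖ ^ 2 := by
  have hD : Continuous (diracOp σ φ) := (contDiff_diracOp hφ).continuous
  have hDc : HasCompactSupport (diracOp σ φ) := by
    refine (hφc.fderiv ℝ).mono' (subset_trans (fun x hx => ?_) subset_closure)
    contrapose! hx
    simp only [Function.mem_support, not_not] at hx
    simp [diracOp, hx]
  have h1 : Integrable fun x => ‖diracOp σ φ x‖ ^ 2 :=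
    (by fun_prop : Continuous fun x => ‖diracOp σ φ x‖ ^ 2).integrable_of_hasCompactSupport
      (hDc.comp_left (g := fun u => ‖u‖ ^ 2) (by simp))
  have h2 : Integrable fun x => ‖φ x‖ ^ 2 := by
    have := hφ.continuous
    exact (by fun_prop : Continuous fun x => ‖φ x‖ ^ 2).integrable_of_hasCompactSupport
      (hφc.comp_left (g := fun u => ‖u‖ ^ 2) (by simp))
  refine Integrable.add (h1.mono' ?_ (.of_forall fun x => ?_)) h2
  · have : Measurable fun x : EuclideanSpace ℝ (Fin 3) => (1 + 1 / ‖x‖) := by fun_prop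
    exact (h1.aestronglyMeasurable.aemeasurable.div this.aemeasurable).aestronglyMeasurable
  · rw [Real.norm_of_nonneg (by positivity)]
    exact div_le_self (by positivity) (le_add_of_nonneg_right (by positivity))

/-- The critical Hardy–Dirac inequality for a general Clifford triple. -/
theorem integral_norm_sq_div_norm_le [FiniteDimensional ℝ F] (hσ : IsCliffordTriple σ)
    (hφ : ContDiff ℝ ∞ φ) (hφc : HasCompactSupport φ) :
    ∫ x, ‖φ x‖ ^ 2 / ‖x‖ ≤ ∫ x, (‖diracOp σ φ x‖ ^ 2 / (1 + 1 / ‖x‖) + ‖φ x‖ ^ 2) := by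
  by_cases hB : Integrable fun x => ‖φ x‖ ^ 2 / ‖x‖
  swap
  · rw [integral_undef hB]
    exact integral_nonneg fun x => by positivity
  have hA := integrable_diracOp_div_add (σ := σ) hφ hφc
  obtain ⟨R, hR, hsupp⟩ := hφc.isCompact.isBounded.subset_ball_lt 0 0
  have hout : ∀ x, R ≤ ‖x‖ → x ∉ tsupport φ := fun x hx h => by
    have := hsupp h
    rw [mem_ball_zero_iff] at this
    linarith
  have hφ0 : ∀ x, R ≤ ‖x‖ → φ x = 0 := fun x hx => image_eq_zero_of_notMem_tsupport (hout x hx)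
  have hD0 : ∀ x, R ≤ ‖x‖ → diracOp σ φ x = 0 := fun x hx => by
    have h : fderiv ℝ φ x = 0 := image_eq_zero_of_notMem_tsupport
      fun h => hout x hx (tsupport_fderiv_subset ℝ h)
    simp [diracOp, h]
  have hpolar := integral_eq_intervalIntegral_sphere (hA.sub hB) hR.le
    fun x hx => by simp [hφ0 x hx.le, hD0 x hx.le]
  simp only [Pi.sub_apply] at hpolar
  rw [← sub_nonneg, ← integral_sub hA hB, hpolar]
  refine (intervalIntegral_radial_nonneg hσ hφ hR fun x hx => hφ0 x hx.ge).trans_eq ?_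
  rw [intervalIntegral.integral_of_le hR.le, intervalIntegral.integral_of_le hR.le]
  refine setIntegral_congr_fun measurableSet_Ioc fun r hr => ?_
  have hr0 : 0 < r := hr.1
  have hDc : Continuous (diracOp σ φ) := (contDiff_diracOp hφ).continuous
  have hφc := hφ.continuous
  rw [← integral_const_mul, ← integral_const_mul, ← integral_const_mul, ← integral_add]
  · refine integral_congr_ae (.of_forall fun y => ?_)
    have hy : ‖r • y.1‖ = r := by simp [norm_smul, abs_of_pos hr0]
    simp only [hy]
    field_simp
    ring
  · exact integrable_sphere_of_continuous (by fun_prop)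
  · exact integrable_sphere_of_continuous (by fun_prop)

end HardyDirac

section Pauli

/-- The Pauli matrices, as real-linear operators on `ℂ²`. -/
def pauli (i : Fin 3) : EuclideanSpace ℂ (Fin 2) →L[ℝ] EuclideanSpace ℂ (Fin 2) :=
  (Matrix.toEuclideanCLM (n := Fin 2) (𝕜 := ℂ)
    (![!![0, 1; 1, 0], !![0, -Complex.I; Complex.I, 0], !![1, 0; 0, -1]] i)).restrictScalars ℝ

lemma pauli_apply (i : Fin 3) (u : EuclideanSpace ℂ (Fin 2)) :
    pauli i u = WithLp.toLp 2 (![![u 1, u 0], ![-Complex.I * u 1, Complex.I * u 0],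
      ![u 0, -u 1]] i) := by
  ext j
  fin_cases i <;> fin_cases j <;>
    simp [pauli, Matrix.ofLp_toEuclideanCLM, Matrix.mulVec, dotProduct, Fin.sum_univ_two]

lemma isCliffordTriple_pauli : IsCliffordTriple pauli where
  symm i u v := by
    fin_cases i <;> simp [pauli_apply, PiLp.inner_apply, Fin.sum_univ_two] <;> ring
  anticomm i j u := by
    ext l
    fin_cases i <;> fin_cases j <;> fin_cases l <;>
      simp [pauli_apply, ← mul_assoc, ← two_mul]

lemma pauliGrad_eq_diracOp (φ : EuclideanSpace ℝ (Fin 3) → EuclideanSpace ℂ (Fin 2)) :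
    pauliGrad φ = diracOp pauli φ := by
  ext x j
  fin_cases j <;> simp [pauliGrad, diracOp, pauli_apply, Fin.sum_univ_three] <;> ring

end Pauli

/-- Critical Hardy–Dirac inequality: for every `φ ∈ C_c^∞(ℝ³, ℂ²)`,
`∫ (|σ·∇φ|²/(1 + 1/|x|) + |φ|²) dx ≥ ∫ |φ|²/|x| dx`. -/
theorem hardy_dirac_critical
    (φ : EuclideanSpace ℝ (Fin 3) → EuclideanSpace ℂ (Fin 2)) (hφ : IsTestFun φ) :
    (∫ x, ‖φ x‖ ^ 2 / ‖x‖) ≤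
      ∫ x, (‖pauliGrad φ x‖ ^ 2 / (1 + 1 / ‖x‖) + ‖φ x‖ ^ 2) := by
  rw [pauliGrad_eq_diracOp]
  exact integral_norm_sq_div_norm_le isCliffordTriple_pauli hφ.1 hφ.2

end
end

section
/- Let V : ℝ³ → ℝ satisfy lim_{|x|→∞} V(x) = 0 and −ν/|x| − c₁ ≤ V(x) ≤ Γ := sup_{ℝ³} V for all x ≠ 0, where ν ∈ (0,1), c₁ ≥ 0, Γ ≥ 0 and c₁ + Γ − 1 < √(1−ν²). Then there exists a constant c(V) ∈ (−1,1) such that for all φ ∈ C_c^∞(ℝ³,ℂ²), ∫_{ℝ³} ( |σ·∇φ|² / (1 + c(V) − V) + (1 − c(V) + V) |φ|² ) dx ≥ 0. -/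
open MeasureTheory

noncomputable section

/-- The `k`-th partial derivative of a real function on `ℝ³`. -/
def partialDeriv (k : Fin 3) (u : EuclideanSpace ℝ (Fin 3) → ℝ)
    (x : EuclideanSpace ℝ (Fin 3)) : ℝ :=
  fderiv ℝ u x (EuclideanSpace.single k (1 : ℝ))

/-- The Jacobian determinant `∇g · (∇u × ∇v)`. -/
def jacobianDet (g u v : EuclideanSpace ℝ (Fin 3) → ℝ) (x : EuclideanSpace ℝ (Fin 3)) : ℝ :=
  partialDeriv 0 g x *
      (partialDeriv 1 u x * partialDeriv 2 v x - partialDeriv 2 u x * partialDeriv 1 v x) +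
    partialDeriv 1 g x *
      (partialDeriv 2 u x * partialDeriv 0 v x - partialDeriv 0 u x * partialDeriv 2 v x) +
    partialDeriv 2 g x *
      (partialDeriv 0 u x * partialDeriv 1 v x - partialDeriv 1 u x * partialDeriv 0 v x)

lemma contDiff_partialDeriv {m n : WithTop ℕ∞} {u : EuclideanSpace ℝ (Fin 3) → ℝ}
    (hu : ContDiff ℝ n u) (hmn : m + 1 ≤ n) (k : Fin 3) : ContDiff ℝ m (partialDeriv k u) :=
  (hu.fderiv_right hmn).clm_apply contDiff_const

lemma hasCompactSupport_partialDeriv {u : EuclideanSpace ℝ (Fin 3) → ℝ}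
    (hu : HasCompactSupport u) (k : Fin 3) : HasCompactSupport (partialDeriv k u) :=
  hu.fderiv_apply ℝ _

lemma partialDeriv_comm {u : EuclideanSpace ℝ (Fin 3) → ℝ} (hu : ContDiff ℝ 2 u) (i j : Fin 3)
    (x : EuclideanSpace ℝ (Fin 3)) :
    partialDeriv i (partialDeriv j u) x = partialDeriv j (partialDeriv i u) x := by
  have hd : DifferentiableAt ℝ (fderiv ℝ u) x :=
    ((hu.fderiv_right (m := 1) (by norm_num)).differentiable one_ne_zero) x
  have key : ∀ i j : Fin 3, partialDeriv i (partialDeriv j u) x =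
      fderiv ℝ (fderiv ℝ u) x (EuclideanSpace.single i 1) (EuclideanSpace.single j 1) := by
    intro i j
    have h : HasFDerivAt (partialDeriv j u) _ x :=
      hd.hasFDerivAt.clm_apply (hasFDerivAt_const (EuclideanSpace.single j (1 : ℝ)) x)
    simp [partialDeriv, h.fderiv]
  rw [key, key]
  exact (hu.contDiffAt.isSymmSndFDerivAt (by simp)) _ _

lemma partialDeriv_mul {u v : EuclideanSpace ℝ (Fin 3) → ℝ} (k : Fin 3)
    {x : EuclideanSpace ℝ (Fin 3)} (hu : DifferentiableAt ℝ u x) (hv : DifferentiableAt ℝ v x) :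
    partialDeriv k (fun y => u y * v y) x =
      partialDeriv k u x * v x + u x * partialDeriv k v x := by
  simp only [partialDeriv]
  rw [fderiv_fun_mul hu hv]
  simp
  ring

/-- Integration by parts against a compactly supported `C¹` function. -/
lemma integral_partialDeriv_mul {g w : EuclideanSpace ℝ (Fin 3) → ℝ} (k : Fin 3)
    (hg : Differentiable ℝ g) (hgk : LocallyIntegrable (partialDeriv k g))
    (hw : ContDiff ℝ 1 w) (hw' : HasCompactSupport w) :
    Integrable (fun x => partialDeriv k g x * w x) ∧
      ∫ x, partialDeriv k g x * w x = -∫ x, g x * partialDeriv k w x := by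
  have h1 : Integrable (fun x => partialDeriv k g x * w x) :=
    hgk.integrable_smul_right_of_hasCompactSupport hw.continuous hw'
  have h2 : Integrable (fun x => g x * partialDeriv k w x) :=
    (hg.continuous.mul (contDiff_partialDeriv (m := 0) hw (by norm_num)
      k).continuous).integrable_of_hasCompactSupport (hasCompactSupport_partialDeriv hw' k).mul_left
  have h3 : Integrable (fun x => g x * w x) :=
    (hg.continuous.mul hw.continuous).integrable_of_hasCompactSupport hw'.mul_left
  refine ⟨h1, ?_⟩
  have := integral_mul_fderiv_eq_neg_fderiv_mul_of_integrable h1 h2 h3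
    (fun x _ => hg x) (fun x _ => hw.differentiable one_ne_zero x)
  simp only [partialDeriv]
  rw [this, neg_neg]

/-- A Jacobian determinant with two compactly supported `C²` entries has vanishing integral. -/
lemma integral_jacobianDet {g u v : EuclideanSpace ℝ (Fin 3) → ℝ}
    (hg : Differentiable ℝ g) (hg' : ∀ k, LocallyIntegrable (partialDeriv k g))
    (hu : ContDiff ℝ 2 u) (hv : ContDiff ℝ 2 v) (hu' : HasCompactSupport u) :
    Integrable (jacobianDet g u v) ∧ ∫ x, jacobianDet g u v x = 0 := by
  have cu : ∀ i, ContDiff ℝ 1 (partialDeriv i u) := contDiff_partialDeriv hu (by norm_num)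
  have cv : ∀ i, ContDiff ℝ 1 (partialDeriv i v) := contDiff_partialDeriv hv (by norm_num)
  have du : ∀ i x, DifferentiableAt ℝ (partialDeriv i u) x :=
    fun i x => (cu i).differentiable one_ne_zero x
  have dv : ∀ i x, DifferentiableAt ℝ (partialDeriv i v) x :=
    fun i x => (cv i).differentiable one_ne_zero x
  set W : Fin 3 → Fin 3 → EuclideanSpace ℝ (Fin 3) → ℝ := fun i j x =>
    partialDeriv i u x * partialDeriv j v x - partialDeriv j u x * partialDeriv i v x with hW
  have cW : ∀ i j, ContDiff ℝ 1 (W i j) := fun i j =>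
    ((cu i).mul (cv j)).sub ((cu j).mul (cv i))
  have sW : ∀ i j, HasCompactSupport (W i j) := fun i j =>
    (hasCompactSupport_partialDeriv hu' i).mul_right.sub
      (hasCompactSupport_partialDeriv hu' j).mul_right
  have dW : ∀ k i j x, partialDeriv k (W i j) x =
      partialDeriv k (partialDeriv i u) x * partialDeriv j v x
      + partialDeriv i u x * partialDeriv k (partialDeriv j v) x
      - (partialDeriv k (partialDeriv j u) x * partialDeriv i v x
      + partialDeriv j u x * partialDeriv k (partialDeriv i v) x) := by
    intro k i j x
    rw [← partialDeriv_mul k (du i x) (dv j x), ← partialDeriv_mul k (du j x) (dv i x)]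
    exact DFunLike.congr_fun (fderiv_sub ((du i x).mul (dv j x)) ((du j x).mul (dv i x))) _
  have ibp := fun k i j => integral_partialDeriv_mul k hg (hg' k) (cW i j) (sW i j)
  have hgW : ∀ k i j, Integrable (fun x => g x * partialDeriv k (W i j) x) := fun k i j =>
    (hg.continuous.mul (contDiff_partialDeriv (m := 0) (cW i j) (by norm_num)
      k).continuous).integrable_of_hasCompactSupport
        (hasCompactSupport_partialDeriv (sW i j) k).mul_left
  have hJ : jacobianDet g u v = fun x => partialDeriv 0 g x * W 1 2 x +
      partialDeriv 1 g x * W 2 0 x + partialDeriv 2 g x * W 0 1 x := rfl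
  have hsum : Integrable
      (fun x => partialDeriv 0 g x * W 1 2 x + partialDeriv 1 g x * W 2 0 x) :=
    (ibp 0 1 2).1.add (ibp 1 2 0).1
  have hgsum : Integrable
      (fun x => g x * partialDeriv 0 (W 1 2) x + g x * partialDeriv 1 (W 2 0) x) :=
    (hgW 0 1 2).add (hgW 1 2 0)
  refine ⟨?_, ?_⟩
  · rw [hJ]
    exact hsum.add (ibp 2 0 1).1
  · simp only [hJ]
    rw [integral_add hsum (ibp 2 0 1).1,
      integral_add (ibp 0 1 2).1 (ibp 1 2 0).1, (ibp 0 1 2).2, (ibp 1 2 0).2, (ibp 2 0 1).2,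
      ← neg_add, ← neg_add, ← integral_add (hgW 0 1 2) (hgW 1 2 0),
      ← integral_add hgsum (hgW 2 0 1), neg_eq_zero]
    refine integral_eq_zero_of_ae (.of_forall fun x => ?_)
    simp only [dW, Pi.zero_apply]
    rw [partialDeriv_comm hu 1 0, partialDeriv_comm hu 2 0, partialDeriv_comm hu 2 1,
      partialDeriv_comm hv 1 0, partialDeriv_comm hv 2 0, partialDeriv_comm hv 2 1]
    ring

lemma locallyIntegrable_inv_norm :
    LocallyIntegrable (fun x : EuclideanSpace ℝ (Fin 3) => ‖x‖⁻¹) := by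
  rw [locallyIntegrable_iff]
  intro K hK
  obtain ⟨R, hR⟩ := hK.isBounded.subset_ball 0
  refine IntegrableOn.mono_set ?_ hR
  rw [integrableOn_fun_norm_addHaar volume (f := fun y => y⁻¹)]
  have : IntegrableOn (fun y : ℝ => y) (Set.Ioo 0 R) :=
    (continuous_id.integrableOn_Icc (a := 0) (b := R)).mono_set Set.Ioo_subset_Icc_self
  refine this.congr_fun (fun y hy => ?_) measurableSet_Ioo
  have : y ≠ 0 := hy.1.ne'
  simp
  field_simp

lemma hasFDerivAt_coord (k : Fin 3) (x : EuclideanSpace ℝ (Fin 3)) :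
    HasFDerivAt (fun y : EuclideanSpace ℝ (Fin 3) => y k)
      (EuclideanSpace.proj k : EuclideanSpace ℝ (Fin 3) →L[ℝ] ℝ) x :=
  (EuclideanSpace.proj k : EuclideanSpace ℝ (Fin 3) →L[ℝ] ℝ).hasFDerivAt

lemma partialDeriv_of_hasFDerivAt {u : EuclideanSpace ℝ (Fin 3) → ℝ}
    {x : EuclideanSpace ℝ (Fin 3)} {u' : EuclideanSpace ℝ (Fin 3) →L[ℝ] ℝ}
    (h : HasFDerivAt u u' x) (k : Fin 3) :
    partialDeriv k u x = u' (EuclideanSpace.single k 1) := by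
  rw [partialDeriv, h.fderiv]

lemma hasFDerivAt_sqrt_norm_sq_add (ε : ℝ) (x : EuclideanSpace ℝ (Fin 3))
    (hx : ‖x‖ ^ 2 + ε ≠ 0) :
    HasFDerivAt (fun y : EuclideanSpace ℝ (Fin 3) => √(‖y‖ ^ 2 + ε))
      ((√(‖x‖ ^ 2 + ε))⁻¹ • innerSL ℝ x) x := by
  have h := ((hasStrictFDerivAt_norm_sq x).hasFDerivAt.add_const ε).sqrt hx
  have hc : (1 / (2 * √(‖x‖ ^ 2 + ε))) • 2 • innerSL ℝ x = (√(‖x‖ ^ 2 + ε))⁻¹ • innerSL ℝ x := by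
    rw [← Nat.cast_smul_eq_nsmul ℝ, smul_smul]
    congr 1
    push_cast
    ring
  rwa [hc] at h

lemma hasFDerivAt_norm_of_ne_zero {x : EuclideanSpace ℝ (Fin 3)} (hx : x ≠ 0) :
    HasFDerivAt (fun y : EuclideanSpace ℝ (Fin 3) => ‖y‖) (‖x‖⁻¹ • innerSL ℝ x) x := by
  simpa using hasFDerivAt_sqrt_norm_sq_add 0 x (by simpa using hx)

lemma partialDeriv_coord_div_sqrt {ε : ℝ} (hε : 0 < ε) (k : Fin 3) :
    Differentiable ℝ (fun x : EuclideanSpace ℝ (Fin 3) => x k * (√(‖x‖ ^ 2 + ε))⁻¹) ∧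
    ∀ x, partialDeriv k (fun x : EuclideanSpace ℝ (Fin 3) => x k * (√(‖x‖ ^ 2 + ε))⁻¹) x =
      (√(‖x‖ ^ 2 + ε))⁻¹ - x k ^ 2 * (√(‖x‖ ^ 2 + ε))⁻¹ ^ 3 := by
  have hρ : ∀ x : EuclideanSpace ℝ (Fin 3), √(‖x‖ ^ 2 + ε) ≠ 0 := fun x => by positivity
  have h : ∀ x : EuclideanSpace ℝ (Fin 3), HasFDerivAt _ _ x := fun x =>
    (hasFDerivAt_coord k x).mul
      (((hasDerivAt_inv (hρ x)).comp_hasFDerivAt x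
        (hasFDerivAt_sqrt_norm_sq_add ε x (by positivity))))
  refine ⟨fun x => (h x).differentiableAt, fun x => ?_⟩
  refine (partialDeriv_of_hasFDerivAt (h x) k).trans ?_
  have := hρ x
  simp [EuclideanSpace.inner_single_right]
  field_simp
  ring

/-- The divergence of the radial unit field is `2 / |x|`, tested against a `C¹` function. -/
lemma integral_radial_deriv {f : EuclideanSpace ℝ (Fin 3) → ℝ} (hf : ContDiff ℝ 1 f)
    (hf' : HasCompactSupport f) :
    Integrable (fun x => (∑ k, x k * partialDeriv k f x) * ‖x‖⁻¹ + 2 * ‖x‖⁻¹ * f x) ∧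
      ∫ x, ((∑ k, x k * partialDeriv k f x) * ‖x‖⁻¹ + 2 * ‖x‖⁻¹ * f x) = 0 := by
  set F : ℕ → EuclideanSpace ℝ (Fin 3) → ℝ := fun n x =>
    (∑ k, x k * partialDeriv k f x) * (√(‖x‖ ^ 2 + 1 / ((n : ℝ) + 1)))⁻¹ +
      (3 * (√(‖x‖ ^ 2 + 1 / ((n : ℝ) + 1)))⁻¹ -
        ‖x‖ ^ 2 * (√(‖x‖ ^ 2 + 1 / ((n : ℝ) + 1)))⁻¹ ^ 3) * f x with hF
  have hε : ∀ n : ℕ, 0 < 1 / ((n : ℝ) + 1) := fun n => by positivity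
  have cf : ∀ k, Continuous (partialDeriv k f) := fun k =>
    (contDiff_partialDeriv (m := 0) hf (by norm_num) k).continuous
  have cρ : ∀ n : ℕ, Continuous
      (fun x : EuclideanSpace ℝ (Fin 3) => (√(‖x‖ ^ 2 + 1 / ((n : ℝ) + 1)))⁻¹) := fun n =>
    Continuous.inv₀ (by fun_prop) fun x => by have := hε n; positivity
  have cF : ∀ n, Continuous (F n) := by
    intro n
    have := cρ n
    have := hf.continuous
    simp only [hF]
    fun_prop
  have hF0 : ∀ n, ∫ x, F n x = 0 := by
    intro n
    set X : Fin 3 → EuclideanSpace ℝ (Fin 3) → ℝ :=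
      fun k x => x k * (√(‖x‖ ^ 2 + 1 / ((n : ℝ) + 1)))⁻¹ with hX
    have hXd := fun k => partialDeriv_coord_div_sqrt (hε n) k
    have cXd : ∀ k, Continuous (partialDeriv k (X k)) := by
      intro k
      have h := funext (hXd k).2
      have := cρ n
      rw [h]
      fun_prop
    have ibp := fun k => integral_partialDeriv_mul k (hXd k).1 (cXd k).locallyIntegrable hf hf'
    have hi : ∀ k, Integrable (fun x => X k x * partialDeriv k f x) := fun k =>
      ((hXd k).1.continuous.mul (cf k)).integrable_of_hasCompactSupport
        (hasCompactSupport_partialDeriv hf' k).mul_left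
    have hk : ∀ k, ∫ x, (X k x * partialDeriv k f x + partialDeriv k (X k) x * f x) = 0 := by
      intro k
      rw [integral_add (hi k) (ibp k).1, (ibp k).2]
      ring
    have hsum : F n = fun x =>
        ∑ k, (X k x * partialDeriv k f x + partialDeriv k (X k) x * f x) := by
      funext x
      simp only [hX, (hXd _).2, hF, EuclideanSpace.real_norm_sq_eq x, Fin.sum_univ_three]
      ring
    have hadd : ∀ k ∈ Finset.univ, Integrable
        (fun x => X k x * partialDeriv k f x + partialDeriv k (X k) x * f x) :=
      fun k _ => (hi k).add (ibp k).1
    simp only [hsum]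
    rw [integral_finsetSum _ hadd]
    exact Finset.sum_eq_zero fun k _ => hk k
  have hlim : ∀ᵐ x : EuclideanSpace ℝ (Fin 3), Filter.Tendsto (fun n => F n x) Filter.atTop
      (nhds ((∑ k, x k * partialDeriv k f x) * ‖x‖⁻¹ + 2 * ‖x‖⁻¹ * f x)) := by
    filter_upwards [compl_mem_ae_iff.mpr (measure_singleton (0 : EuclideanSpace ℝ (Fin 3)))]
      with x hx
    have hx : 0 < ‖x‖ := norm_pos_iff.mpr hx
    have hρ : Filter.Tendsto (fun n : ℕ => (√(‖x‖ ^ 2 + 1 / ((n : ℝ) + 1)))⁻¹) Filter.atTop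
        (nhds ‖x‖⁻¹) := by
      have h := (tendsto_one_div_add_atTop_nhds_zero_nat (𝕜 := ℝ)).const_add (‖x‖ ^ 2)
      simpa using (h.sqrt.inv₀ (by simpa using hx.ne'))
    have := ((hρ.const_mul (∑ k, x k * partialDeriv k f x)).add
      (((hρ.const_mul 3).sub ((hρ.pow 3).const_mul (‖x‖ ^ 2))).mul_const (f x)))
    convert this using 2
    field_simp
    ring
  have hbd : ∀ n, ∀ᵐ x : EuclideanSpace ℝ (Fin 3),
      ‖F n x‖ ≤ (∑ k, ‖partialDeriv k f x‖) + 3 * ‖‖x‖⁻¹ * f x‖ := by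
    intro n
    filter_upwards [compl_mem_ae_iff.mpr (measure_singleton (0 : EuclideanSpace ℝ (Fin 3)))]
      with x hx
    have hx : 0 < ‖x‖ := norm_pos_iff.mpr hx
    set ρ := √(‖x‖ ^ 2 + 1 / ((n : ℝ) + 1)) with hρdef
    have hle : ‖x‖ ≤ ρ := Real.le_sqrt_of_sq_le (by linarith [hε n])
    have hρ : 0 < ρ := hx.trans_le hle
    have hinv : ρ⁻¹ ≤ ‖x‖⁻¹ := inv_anti₀ hx hle
    have hcoord : ∀ k, ‖x k * ρ⁻¹‖ ≤ 1 := by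
      intro k
      rw [norm_mul, norm_inv, Real.norm_of_nonneg hρ.le, ← div_eq_mul_inv, div_le_one hρ]
      exact (PiLp.norm_apply_le x k).trans hle
    have hcoef : ‖3 * ρ⁻¹ - ‖x‖ ^ 2 * ρ⁻¹ ^ 3‖ ≤ 3 * ‖x‖⁻¹ := by
      have h1 : ‖x‖ ^ 2 * ρ⁻¹ ^ 2 ≤ 1 := by
        rw [← mul_pow]
        refine pow_le_one₀ (by positivity) ?_
        rw [← div_eq_mul_inv, div_le_one hρ]
        exact hle
      have h2 : 0 < ρ⁻¹ := by positivity
      have h3 : 0 ≤ ‖x‖ ^ 2 * ρ⁻¹ ^ 3 := by positivity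
      have h4 : ‖x‖ ^ 2 * ρ⁻¹ ^ 3 ≤ ρ⁻¹ := by nlinarith
      rw [Real.norm_eq_abs, abs_le]
      constructor <;> linarith
    calc ‖F n x‖ ≤ ‖∑ k, (x k * ρ⁻¹) * partialDeriv k f x‖ +
          ‖(3 * ρ⁻¹ - ‖x‖ ^ 2 * ρ⁻¹ ^ 3) * f x‖ := by
          refine le_trans (le_of_eq ?_) (norm_add_le _ _)
          simp only [hF, ← hρdef, Fin.sum_univ_three]
          ring_nf
      _ ≤ (∑ k, ‖partialDeriv k f x‖) + 3 * ‖‖x‖⁻¹ * f x‖ := by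
          refine add_le_add ((norm_sum_le _ _).trans (Finset.sum_le_sum fun k _ => ?_)) ?_
          · rw [norm_mul]
            exact mul_le_of_le_one_left (norm_nonneg _) (hcoord k)
          · rw [norm_mul, norm_mul, norm_inv, norm_norm, ← mul_assoc]
            exact mul_le_mul_of_nonneg_right hcoef (norm_nonneg _)
  have hbi : Integrable (fun x : EuclideanSpace ℝ (Fin 3) =>
      (∑ k, ‖partialDeriv k f x‖) + 3 * ‖‖x‖⁻¹ * f x‖) := by
    refine (integrable_finsetSum _ fun k _ => ?_).add (Integrable.const_mul ?_ 3)
    · exact ((cf k).integrable_of_hasCompactSupport (hasCompactSupport_partialDeriv hf' k)).norm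
    · exact (locallyIntegrable_inv_norm.integrable_smul_right_of_hasCompactSupport
        hf.continuous hf').norm
  have hmeas := aestronglyMeasurable_of_tendsto_ae Filter.atTop
    (fun n => (cF n).aestronglyMeasurable) hlim
  refine ⟨hbi.mono' hmeas ?_, ?_⟩
  · filter_upwards [hlim, ae_all_iff.mpr hbd] with x hx hb
    exact le_of_tendsto hx.norm (.of_forall hb)
  · have h := tendsto_integral_of_dominated_convergence _
      (fun n => (cF n).aestronglyMeasurable) hbi hbd hlim
    simp only [hF0] at h
    exact (tendsto_nhds_unique tendsto_const_nhds h).symm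

/-- The components of the field `|x| x / (a |x| + b)`. -/
def radialField (a b : ℝ) (l : Fin 3) (x : EuclideanSpace ℝ (Fin 3)) : ℝ :=
  ‖x‖ * x l * (a * ‖x‖ + b)⁻¹

lemma partialDeriv_radialField {a b : ℝ} (ha : 0 < a) (hb : 0 < b) (l : Fin 3) :
    Differentiable ℝ (radialField a b l) ∧
    ∀ k x, partialDeriv k (radialField a b l) x =
      ‖x‖ * (a * ‖x‖ + b)⁻¹ * (if k = l then 1 else 0) +
        b * (x k * x l * ‖x‖⁻¹) * (a * ‖x‖ + b)⁻¹ ^ 2 := by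
  have key : ∀ x, ∃ L : EuclideanSpace ℝ (Fin 3) →L[ℝ] ℝ, HasFDerivAt (radialField a b l) L x ∧
      ∀ k, L (EuclideanSpace.single k 1) =
        ‖x‖ * (a * ‖x‖ + b)⁻¹ * (if k = l then 1 else 0) +
        b * (x k * x l * ‖x‖⁻¹) * (a * ‖x‖ + b)⁻¹ ^ 2 := by
    intro x
    have hp : a * ‖x‖ + b ≠ 0 := by positivity
    rcases eq_or_ne x 0 with rfl | hx
    · refine ⟨0, Asymptotics.IsBigO.hasFDerivAt (n := 2) ?_ one_lt_two, by simp⟩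
      refine Asymptotics.IsBigO.of_bound b⁻¹ (.of_forall fun y => ?_)
      have hpy : 0 < a * ‖y‖ + b := by positivity
      have h1 : (a * ‖y‖ + b)⁻¹ ≤ b⁻¹ := inv_anti₀ hb (by nlinarith [norm_nonneg y])
      have h2 : ‖y l‖ ≤ ‖y‖ := PiLp.norm_apply_le y l
      have h3 : 0 < (a * ‖y‖ + b)⁻¹ := by positivity
      rw [radialField, norm_mul, norm_mul, norm_norm, Real.norm_of_nonneg h3.le, sub_zero,
        Real.norm_of_nonneg (sq_nonneg ‖y‖), mul_comm b⁻¹, sq]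
      gcongr
    · have hn := hasFDerivAt_norm_of_ne_zero hx
      have hx' : ‖x‖ ≠ 0 := norm_ne_zero_iff.mpr hx
      have h := (hn.mul (hasFDerivAt_coord l x)).mul
        ((hasDerivAt_inv hp).comp_hasFDerivAt x ((hn.const_mul a).add_const b))
      refine ⟨_, h, fun k => ?_⟩
      by_cases hkl : k = l
      · subst hkl
        simp [EuclideanSpace.inner_single_right]
        field_simp
        ring
      · have hlk : l ≠ k := fun h => hkl h.symm
        simp [EuclideanSpace.inner_single_right, hkl, hlk]
        field_simp
        ring
  refine ⟨fun x => (key x).choose_spec.1.differentiableAt, fun k x => ?_⟩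
  rw [partialDeriv_of_hasFDerivAt (key x).choose_spec.1, (key x).choose_spec.2]

lemma locallyIntegrable_partialDeriv_radialField {a b : ℝ} (ha : 0 < a) (hb : 0 < b)
    (k l : Fin 3) : LocallyIntegrable (partialDeriv k (radialField a b l)) := by
  refine (locallyIntegrable_const (a⁻¹ + a⁻¹)).mono
    (measurable_fderiv_apply_const ℝ _ _).aestronglyMeasurable (.of_forall fun x => ?_)
  have hp : 0 < a * ‖x‖ + b := by positivity
  have h1 : ‖x‖ * (a * ‖x‖ + b)⁻¹ ≤ a⁻¹ := by
    rw [← div_eq_mul_inv, div_le_iff₀ hp, mul_add, inv_mul_cancel_left₀ ha.ne']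
    have : 0 < a⁻¹ * b := by positivity
    linarith
  have h2 : b * (a * ‖x‖ + b)⁻¹ ≤ 1 := by
    rw [← div_eq_mul_inv, div_le_one hp]
    nlinarith [norm_nonneg x]
  have h3 : ‖x k * x l * ‖x‖⁻¹‖ ≤ ‖x‖ := by
    rw [norm_mul, norm_mul, norm_inv, norm_norm]
    calc ‖x k‖ * ‖x l‖ * ‖x‖⁻¹ ≤ ‖x‖ * ‖x‖ * ‖x‖⁻¹ := by
          gcongr <;> exact PiLp.norm_apply_le x _
      _ ≤ ‖x‖ := by rcases eq_or_ne ‖x‖ 0 with h | h <;> simp [h]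
  have h4 : 0 < (a * ‖x‖ + b)⁻¹ := by positivity
  rw [(partialDeriv_radialField ha hb l).2, Real.norm_of_nonneg (by positivity : 0 ≤ a⁻¹ + a⁻¹)]
  refine (norm_add_le _ _).trans (add_le_add ?_ ?_)
  · rw [norm_mul, Real.norm_of_nonneg (by positivity)]
    refine (mul_le_of_le_one_right (by positivity) ?_).trans h1
    split_ifs <;> simp
  · calc ‖b * (x k * x l * ‖x‖⁻¹) * (a * ‖x‖ + b)⁻¹ ^ 2‖
          = ‖x k * x l * ‖x‖⁻¹‖ * (a * ‖x‖ + b)⁻¹ * (b * (a * ‖x‖ + b)⁻¹) := by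
          rw [norm_mul, norm_mul, Real.norm_of_nonneg hb.le, norm_pow, Real.norm_of_nonneg h4.le]
          ring
      _ ≤ ‖x‖ * (a * ‖x‖ + b)⁻¹ * 1 := by gcongr
      _ ≤ a⁻¹ := by rw [mul_one]; exact h1

/-- The triple product `n · (u × v)`. -/
def tripleProd (n u v : Fin 3 → ℝ) : ℝ :=
  n 0 * (u 1 * v 2 - u 2 * v 1) + n 1 * (u 2 * v 0 - u 0 * v 2) + n 2 * (u 0 * v 1 - u 1 * v 0)

/-- `∑ₗ Gₗ · (a × iσₗ a)` for a triple of spinors `a` with real components `p, q, c, d`. -/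
def spinForm (G : Fin 3 → Fin 3 → ℝ) (p q c d : Fin 3 → ℝ) : ℝ :=
  2 * (tripleProd (G 0) q c - tripleProd (G 0) p d + tripleProd (G 1) p c +
    tripleProd (G 1) q d - tripleProd (G 2) p q + tripleProd (G 2) c d)

/-- `|σ·a|²` for a triple of spinors `a` with real components `p, q, c, d`. -/
def pauliSq (p q c d : Fin 3 → ℝ) : ℝ :=
  (c 0 + d 1 + p 2) ^ 2 + (d 0 - c 1 + q 2) ^ 2 + (p 0 - q 1 - c 2) ^ 2 + (q 0 + p 1 - d 2) ^ 2

lemma spinForm_normal_le (n p q c d : Fin 3 → ℝ) (hn : n 0 ^ 2 + n 1 ^ 2 + n 2 ^ 2 = 1) :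
    spinForm (fun l k => n k * n l) p q c d ≤
      (∑ k, (p k ^ 2 + q k ^ 2 + c k ^ 2 + d k ^ 2)) -
        ((∑ k, n k * p k) ^ 2 + (∑ k, n k * q k) ^ 2 + (∑ k, n k * c k) ^ 2 +
          (∑ k, n k * d k) ^ 2) := by
  have key : ∀ u : Fin 3 → ℝ, ∃ u' : Fin 3 → ℝ,
      u' 0 = u 1 * n 2 - u 2 * n 1 ∧ u' 1 = u 2 * n 0 - u 0 * n 2 ∧
      u' 2 = u 0 * n 1 - u 1 * n 0 := fun u =>
    ⟨![u 1 * n 2 - u 2 * n 1, u 2 * n 0 - u 0 * n 2, u 0 * n 1 - u 1 * n 0], rfl, rfl, rfl⟩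
  obtain ⟨p', hp0, hp1, hp2⟩ := key p
  obtain ⟨q', hq0, hq1, hq2⟩ := key q
  obtain ⟨c', hc0, hc1, hc2⟩ := key c
  obtain ⟨d', hd0, hd1, hd2⟩ := key d
  have hsq : 0 ≤ ∑ j,
      ((p j - n j * (∑ k, n k * p k) - (-(n 0 * d' j) + n 1 * c' j - n 2 * q' j)) ^ 2 +
       (q j - n j * (∑ k, n k * q k) - (n 0 * c' j + n 1 * d' j + n 2 * p' j)) ^ 2 +
       (c j - n j * (∑ k, n k * c k) - (-(n 0 * q' j) - n 1 * p' j + n 2 * d' j)) ^ 2 +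
       (d j - n j * (∑ k, n k * d k) - (n 0 * p' j - n 1 * q' j - n 2 * c' j)) ^ 2) := by
    positivity
  simp only [Fin.sum_univ_three, spinForm, tripleProd, hp0, hp1, hp2, hq0, hq1, hq2, hc0, hc1, hc2,
    hd0, hd1, hd2] at hsq ⊢
  rw [← sub_nonneg]
  refine le_of_le_of_eq (mul_nonneg one_half_pos.le hsq) ?_
  linear_combination (1 / 2 * (n 0 ^ 2 + n 1 ^ 2 + n 2 ^ 2 + 1) *
    (p 0 ^ 2 + p 1 ^ 2 + p 2 ^ 2 + q 0 ^ 2 + q 1 ^ 2 + q 2 ^ 2 + c 0 ^ 2 + c 1 ^ 2 + c 2 ^ 2 +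
      d 0 ^ 2 + d 1 ^ 2 + d 2 ^ 2)) * hn

lemma spinForm_add_radial_le (n p q c d : Fin 3 → ℝ) (hn : n 0 ^ 2 + n 1 ^ 2 + n 2 ^ 2 = 1)
    {h m : ℝ} (hm : 0 ≤ m) (hmh : m ≤ h) :
    spinForm (fun l k => h * (if k = l then 1 else 0) + m * (n k * n l)) p q c d +
        h * ((∑ k, n k * p k) ^ 2 + (∑ k, n k * q k) ^ 2 + (∑ k, n k * c k) ^ 2 +
          (∑ k, n k * d k) ^ 2) ≤ h * pauliSq p q c d := by
  have hN := spinForm_normal_le n p q c d hn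
  set A := ∑ k, (p k ^ 2 + q k ^ 2 + c k ^ 2 + d k ^ 2) with hA
  set B := (∑ k, n k * p k) ^ 2 + (∑ k, n k * q k) ^ 2 + (∑ k, n k * c k) ^ 2 +
    (∑ k, n k * d k) ^ 2 with hB
  have hAB : B ≤ A := by
    have hcs : ∀ u : Fin 3 → ℝ, (∑ k, n k * u k) ^ 2 ≤ ∑ k, u k ^ 2 := by
      intro u
      refine (Finset.sum_mul_sq_le_sq_mul_sq _ _ _).trans (le_of_eq ?_)
      rw [Fin.sum_univ_three (fun k => n k ^ 2), hn, one_mul]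
    simp only [hA, Finset.sum_add_distrib]
    linarith [hcs p, hcs q, hcs c, hcs d]
  have hsplit : spinForm (fun l k => h * (if k = l then 1 else 0) + m * (n k * n l)) p q c d =
      h * (pauliSq p q c d - A) + m * spinForm (fun l k => n k * n l) p q c d := by
    simp [spinForm, tripleProd, pauliSq, hA, Fin.sum_univ_three]
    ring
  rw [hsplit]
  nlinarith [mul_le_mul_of_nonneg_left hN hm, mul_nonneg (sub_nonneg.mpr hmh) (sub_nonneg.mpr hAB)]

/-- The radial part of the inequality, obtained by completing the square with the logarithmic
derivative of the Coulomb ground state. -/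
lemma radial_square_bound {s ν r : ℝ} (hs : 0 ≤ s) (hsν : s ^ 2 = 1 - ν ^ 2) (hν : 0 < ν)
    (hr : 0 < r) (y z : ℝ) :
    -(ν / (1 + s)) * (2 * (y * z) + 2 * r⁻¹ * z ^ 2) ≤
      r * ((1 + s) * r + ν)⁻¹ * y ^ 2 + (1 - s - ν / r) * z ^ 2 := by
  have h1 : 0 < (1 + s) * r + ν := by positivity
  have h2 : 0 < 1 + s := by positivity
  rw [← sub_nonneg]
  have : r * ((1 + s) * r + ν)⁻¹ * y ^ 2 + (1 - s - ν / r) * z ^ 2 -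
      -(ν / (1 + s)) * (2 * (y * z) + 2 * r⁻¹ * z ^ 2) =
      r * ((1 + s) * r + ν)⁻¹ * (y + ν / (1 + s) * ((1 + s) * r + ν) * r⁻¹ * z) ^ 2 := by
    field_simp
    linear_combination (-z ^ 2 * ((1 + s) * r + ν) ^ 2) * hsν
  rw [this]
  positivity

lemma fderiv_component_re {φ : EuclideanSpace ℝ (Fin 3) → EuclideanSpace ℂ (Fin 2)}
    (hφ : Differentiable ℝ φ) (i : Fin 2) (k : Fin 3) (x : EuclideanSpace ℝ (Fin 3)) :
    (fderiv ℝ φ x (EuclideanSpace.single k (1 : ℝ)) i).re =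
      partialDeriv k (fun y => (φ y i).re) x := by
  have h := (Complex.reCLM.comp
    ((EuclideanSpace.proj i : EuclideanSpace ℂ (Fin 2) →L[ℂ] ℂ).restrictScalars
      ℝ)).hasFDerivAt.comp x (hφ x).hasFDerivAt
  exact (partialDeriv_of_hasFDerivAt h k).symm

lemma fderiv_component_im {φ : EuclideanSpace ℝ (Fin 3) → EuclideanSpace ℂ (Fin 2)}
    (hφ : Differentiable ℝ φ) (i : Fin 2) (k : Fin 3) (x : EuclideanSpace ℝ (Fin 3)) :
    (fderiv ℝ φ x (EuclideanSpace.single k (1 : ℝ)) i).im =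
      partialDeriv k (fun y => (φ y i).im) x := by
  have h := (Complex.imCLM.comp
    ((EuclideanSpace.proj i : EuclideanSpace ℂ (Fin 2) →L[ℂ] ℂ).restrictScalars
      ℝ)).hasFDerivAt.comp x (hφ x).hasFDerivAt
  exact (partialDeriv_of_hasFDerivAt h k).symm

lemma norm_sq_pauliGrad {φ : EuclideanSpace ℝ (Fin 3) → EuclideanSpace ℂ (Fin 2)}
    (hφ : Differentiable ℝ φ) (x : EuclideanSpace ℝ (Fin 3)) :
    ‖pauliGrad φ x‖ ^ 2 = pauliSq (fun k => partialDeriv k (fun y => (φ y 0).re) x)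
      (fun k => partialDeriv k (fun y => (φ y 0).im) x)
      (fun k => partialDeriv k (fun y => (φ y 1).re) x)
      (fun k => partialDeriv k (fun y => (φ y 1).im) x) := by
  simp only [← fderiv_component_re hφ, ← fderiv_component_im hφ]
  rw [EuclideanSpace.norm_sq_eq, Fin.sum_univ_two]
  simp [pauliGrad, pauliSq, Complex.sq_norm, Complex.normSq_apply]
  ring

lemma integral_spinForm {G : Fin 3 → EuclideanSpace ℝ (Fin 3) → ℝ}
    {p q c d : EuclideanSpace ℝ (Fin 3) → ℝ}
    (hG : ∀ l, Differentiable ℝ (G l)) (hG' : ∀ l k, LocallyIntegrable (partialDeriv k (G l)))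
    (hp : ContDiff ℝ 2 p) (hq : ContDiff ℝ 2 q) (hc : ContDiff ℝ 2 c) (hd : ContDiff ℝ 2 d)
    (hp' : HasCompactSupport p) (hq' : HasCompactSupport q) (hc' : HasCompactSupport c) :
    Integrable (fun x => spinForm (fun l k => partialDeriv k (G l) x) (partialDeriv · p x)
        (partialDeriv · q x) (partialDeriv · c x) (partialDeriv · d x)) ∧
      ∫ x, spinForm (fun l k => partialDeriv k (G l) x) (partialDeriv · p x)
        (partialDeriv · q x) (partialDeriv · c x) (partialDeriv · d x) = 0 := by
  have h1 := integral_jacobianDet (hG 0) (hG' 0) hq hc hq'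
  have h2 := integral_jacobianDet (hG 0) (hG' 0) hp hd hp'
  have h3 := integral_jacobianDet (hG 1) (hG' 1) hp hc hp'
  have h4 := integral_jacobianDet (hG 1) (hG' 1) hq hd hq'
  have h5 := integral_jacobianDet (hG 2) (hG' 2) hp hq hp'
  have h6 := integral_jacobianDet (hG 2) (hG' 2) hc hd hc'
  have i2 := h1.1.sub h2.1
  have i3 := i2.add h3.1
  have i4 := i3.add h4.1
  have i5 := i4.sub h5.1
  have i6 := i5.add h6.1
  have heq : (fun x => spinForm (fun l k => partialDeriv k (G l) x) (partialDeriv · p x)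
        (partialDeriv · q x) (partialDeriv · c x) (partialDeriv · d x)) =
      fun x => 2 * (jacobianDet (G 0) q c - jacobianDet (G 0) p d + jacobianDet (G 1) p c +
        jacobianDet (G 1) q d - jacobianDet (G 2) p q + jacobianDet (G 2) c d) x := rfl
  rw [heq]
  refine ⟨i6.const_mul 2, ?_⟩
  rw [integral_const_mul, integral_add' i5 h6.1, integral_sub' i4 h5.1, integral_add' i3 h4.1,
    integral_add' i2 h3.1, integral_sub' h1.1 h2.1, h1.2, h2.2, h3.2, h4.2, h5.2, h6.2]
  simp

/-- Theorem 1 (Hardy–Dirac inequality, [DES00]): if `V → 0` at infinity and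
`-ν/|x| - c₁ ≤ V ≤ Γ := sup V` for `x ≠ 0`, with `ν ∈ (0,1)`, `c₁, Γ ≥ 0` and
`c₁ + Γ - 1 < √(1 - ν²)`, then there is `c(V) ∈ (-1,1)` such that for all
test spinors `φ`, `∫ (|σ·∇φ|²/(1 + c(V) - V) + (1 - c(V) + V)|φ|²) dx ≥ 0`. -/
theorem hardy_dirac_inequality
    (V : EuclideanSpace ℝ (Fin 3) → ℝ) (ν c₁ Γ : ℝ)
    (hν : ν ∈ Set.Ioo (0 : ℝ) 1) (hc₁ : 0 ≤ c₁) (hΓ0 : 0 ≤ Γ)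
    (hΓ : Γ = ⨆ x, V x)
    (hcrit : c₁ + Γ - 1 < Real.sqrt (1 - ν ^ 2))
    (hlim : Filter.Tendsto V (Filter.cocompact (EuclideanSpace ℝ (Fin 3))) (nhds 0))
    (hlow : ∀ x : EuclideanSpace ℝ (Fin 3), x ≠ 0 → -ν / ‖x‖ - c₁ ≤ V x)
    (hup : ∀ x : EuclideanSpace ℝ (Fin 3), x ≠ 0 → V x ≤ Γ) :
    ∃ c ∈ Set.Ioo (-1 : ℝ) 1,
      ∀ φ : EuclideanSpace ℝ (Fin 3) → EuclideanSpace ℂ (Fin 2), IsTestFun φ →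
        0 ≤ ∫ x, (‖pauliGrad φ x‖ ^ 2 / (1 + c - V x) + (1 - c + V x) * ‖φ x‖ ^ 2) := by
  obtain ⟨hν0, hν1⟩ := hν
  set s := √(1 - ν ^ 2) with hs_def
  have hν2 : 0 < 1 - ν ^ 2 := by nlinarith
  have hs : 0 < s := Real.sqrt_pos.mpr hν2
  have hsν : s ^ 2 = 1 - ν ^ 2 := Real.sq_sqrt hν2.le
  have hs1 : s < 1 := by nlinarith
  refine ⟨s - c₁, ⟨by linarith, by linarith⟩, fun φ hφ => ?_⟩
  by_cases hint : Integrable (fun x =>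
      ‖pauliGrad φ x‖ ^ 2 / (1 + (s - c₁) - V x) + (1 - (s - c₁) + V x) * ‖φ x‖ ^ 2)
  swap
  · rw [integral_undef hint]
  obtain ⟨hsm, hcs⟩ := hφ
  have hsm2 : ContDiff ℝ 2 φ := hsm.of_le (WithTop.coe_le_coe.mpr (le_top : (2 : ℕ∞) ≤ ⊤))
  have hdiff : Differentiable ℝ φ := hsm2.differentiable two_ne_zero
  have hcomp : ∀ i, ContDiff ℝ 2 (fun x => φ x i) := fun i =>
    ((EuclideanSpace.proj i : EuclideanSpace ℂ (Fin 2) →L[ℂ] ℂ).restrictScalars ℝ).contDiff.comp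
      hsm2
  have hre : ∀ i, ContDiff ℝ 2 (fun x => (φ x i).re) := fun i =>
    Complex.reCLM.contDiff.comp (hcomp i)
  have him : ∀ i, ContDiff ℝ 2 (fun x => (φ x i).im) := fun i =>
    Complex.imCLM.contDiff.comp (hcomp i)
  have hre' : ∀ i, HasCompactSupport (fun x => (φ x i).re) := fun i =>
    hcs.comp_left (g := fun z : EuclideanSpace ℂ (Fin 2) => (z i).re) (by simp)
  have him' : ∀ i, HasCompactSupport (fun x => (φ x i).im) := fun i =>
    hcs.comp_left (g := fun z : EuclideanSpace ℂ (Fin 2) => (z i).im) (by simp)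
  set p := fun x => (φ x 0).re with hp
  set q := fun x => (φ x 0).im with hq
  set c := fun x => (φ x 1).re with hc
  set d := fun x => (φ x 1).im with hd
  have hnorm : ∀ x, ‖φ x‖ ^ 2 = p x ^ 2 + q x ^ 2 + c x ^ 2 + d x ^ 2 := by
    intro x
    rw [EuclideanSpace.norm_sq_eq, Fin.sum_univ_two, Complex.sq_norm, Complex.sq_norm,
      Complex.normSq_apply, Complex.normSq_apply]
    ring
  set f := fun x => p x * p x + q x * q x + c x * c x + d x * d x with hf
  have hfC : ContDiff ℝ 1 f :=
    (((((hre 0).mul (hre 0)).add ((him 0).mul (him 0))).add ((hre 1).mul (hre 1))).add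
      ((him 1).mul (him 1))).of_le one_le_two
  have hfS : HasCompactSupport f :=
    (((hre' 0).mul_right.add (him' 0).mul_right).add (hre' 1).mul_right).add (him' 1).mul_right
  have hfd : ∀ k x, partialDeriv k f x = 2 * (p x * partialDeriv k p x + q x * partialDeriv k q x +
      c x * partialDeriv k c x + d x * partialDeriv k d x) := by
    intro k x
    have dd : ∀ {u : EuclideanSpace ℝ (Fin 3) → ℝ}, ContDiff ℝ 2 u →
        HasFDerivAt u (fderiv ℝ u x) x :=
      fun hu => (hu.differentiable two_ne_zero x).hasFDerivAt
    have hsum := ((((dd (hre 0)).mul (dd (hre 0))).add ((dd (him 0)).mul (dd (him 0)))).add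
      ((dd (hre 1)).mul (dd (hre 1)))).add ((dd (him 1)).mul (dd (him 1)))
    refine (partialDeriv_of_hasFDerivAt hsum k).trans ?_
    simp [partialDeriv, hp, hq, hc, hd]
    ring
  have hs1' : 0 < 1 + s := by linarith
  obtain ⟨iS, jS⟩ := integral_spinForm (G := radialField (1 + s) ν)
    (fun l => (partialDeriv_radialField hs1' hν0 l).1)
    (fun l k => locallyIntegrable_partialDeriv_radialField hs1' hν0 k l)
    (hre 0) (him 0) (hre 1) (him 1) (hre' 0) (him' 0) (hre' 1)
  obtain ⟨iR, jR⟩ := integral_radial_deriv hfC hfS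
  have iR' := iR.const_mul (-(ν / (1 + s)))
  have hzero := integral_add iS iR'
  rw [integral_const_mul, jS, jR, mul_zero, add_zero] at hzero
  rw [← hzero]
  refine integral_mono_ae (iS.add iR') hint ?_
  filter_upwards [compl_mem_ae_iff.mpr (measure_singleton (0 : EuclideanSpace ℝ (Fin 3)))]
    with x hx
  have hx0 : x ≠ 0 := hx
  have hr : 0 < ‖x‖ := norm_pos_iff.mpr hx0
  have hlo := hlow x hx0
  have hhi := hup x hx0
  have hP : 0 < (1 + s) * ‖x‖ + ν := by positivity
  set h := ‖x‖ * ((1 + s) * ‖x‖ + ν)⁻¹ with hh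
  set m := ν * ‖x‖ * ((1 + s) * ‖x‖ + ν)⁻¹ ^ 2 with hm
  have hm0 : 0 ≤ m := by positivity
  have hmh : m ≤ h := by
    have h1 : ν * ((1 + s) * ‖x‖ + ν)⁻¹ ≤ 1 := by
      rw [← div_eq_mul_inv, div_le_one hP]
      have : 0 < (1 + s) * ‖x‖ := by positivity
      linarith
    have h2 : m = ν * ((1 + s) * ‖x‖ + ν)⁻¹ * h := by rw [hm, hh]; ring
    rw [h2]
    exact mul_le_of_le_one_left (by positivity) h1
  have hn : (x 0 * ‖x‖⁻¹) ^ 2 + (x 1 * ‖x‖⁻¹) ^ 2 + (x 2 * ‖x‖⁻¹) ^ 2 = 1 := by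
    have := EuclideanSpace.real_norm_sq_eq x
    rw [Fin.sum_univ_three] at this
    rw [mul_pow, mul_pow, mul_pow, ← add_mul, ← add_mul, ← this]
    field_simp
  have hpt := spinForm_add_radial_le (fun k => x k * ‖x‖⁻¹) (partialDeriv · p x)
    (partialDeriv · q x) (partialDeriv · c x) (partialDeriv · d x) hn hm0 hmh
  have hG : (fun l k => partialDeriv k (radialField (1 + s) ν l) x) = fun l k =>
      h * (if k = l then 1 else 0) + m * (x k * ‖x‖⁻¹ * (x l * ‖x‖⁻¹)) := by
    funext l k
    rw [(partialDeriv_radialField hs1' hν0 l).2, hh, hm]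
    field_simp
  rw [← hG, ← norm_sq_pauliGrad hdiff] at hpt
  have hrad := radial_square_bound hs.le hsν hν0 hr
  have hp1 := hrad (∑ k, x k * ‖x‖⁻¹ * partialDeriv k p x) (p x)
  have hq1 := hrad (∑ k, x k * ‖x‖⁻¹ * partialDeriv k q x) (q x)
  have hc1 := hrad (∑ k, x k * ‖x‖⁻¹ * partialDeriv k c x) (c x)
  have hd1 := hrad (∑ k, x k * ‖x‖⁻¹ * partialDeriv k d x) (d x)
  rw [← hh] at hp1 hq1 hc1 hd1
  have hden : 0 < 1 + (s - c₁) - V x := by linarith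
  have hneg : -ν / ‖x‖ = -(ν / ‖x‖) := neg_div _ _
  have hgrad : h * ‖pauliGrad φ x‖ ^ 2 ≤ ‖pauliGrad φ x‖ ^ 2 / (1 + (s - c₁) - V x) := by
    rw [mul_comm, div_eq_mul_inv]
    refine mul_le_mul_of_nonneg_left ?_ (sq_nonneg _)
    have hinv : h = (1 + s + ν / ‖x‖)⁻¹ := by
      rw [hh]
      field_simp
    rw [hinv]
    exact inv_anti₀ hden (by linarith)
  have hpot : (1 - s - ν / ‖x‖) * ‖φ x‖ ^ 2 ≤ (1 - (s - c₁) + V x) * ‖φ x‖ ^ 2 :=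
    mul_le_mul_of_nonneg_right (by linarith) (sq_nonneg _)
  have hradial : (∑ k, x k * partialDeriv k f x) * ‖x‖⁻¹ + 2 * ‖x‖⁻¹ * f x =
      (2 * ((∑ k, x k * ‖x‖⁻¹ * partialDeriv k p x) * p x) + 2 * ‖x‖⁻¹ * p x ^ 2) +
      (2 * ((∑ k, x k * ‖x‖⁻¹ * partialDeriv k q x) * q x) + 2 * ‖x‖⁻¹ * q x ^ 2) +
      (2 * ((∑ k, x k * ‖x‖⁻¹ * partialDeriv k c x) * c x) + 2 * ‖x‖⁻¹ * c x ^ 2) +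
      (2 * ((∑ k, x k * ‖x‖⁻¹ * partialDeriv k d x) * d x) + 2 * ‖x‖⁻¹ * d x ^ 2) := by
    simp only [hfd, Fin.sum_univ_three]
    simp only [hf]
    ring
  refine le_trans ?_ (add_le_add hgrad hpot)
  rw [hradial, hnorm x]
  linarith

end
end
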